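/- arXiv:1308.6532 — 3 statements merged into one kernel-verified Lean document; each statement's English description precedes it below -/
import Mathlib

section
/- Let 1/2 < s ≤ 1 and 0 < σ < 2s − 1. Then there exists a constant C > 0 such that for all Schwartz functions u, v on ℝ², ‖uv‖_{H^{1−s}} ≤ C ‖u‖_{H^s} ‖v‖_{Ḣ^{1−σ}}. -/
open MeasureTheory Real
open scoped FourierTransform

noncomputable section

abbrev Plane := EuclideanSpace ℝ (Fin 2)

/-- The inhomogeneous Sobolev norm `‖f‖_{H^s} = (∫ (1+|ξ|²)^s |f̂(ξ)|² dξ)^{1/2}` on ℝ². -/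
def sobNorm (s : ℝ) (f : Plane → ℂ) : ℝ :=
  (∫ ξ : Plane, (1 + ‖ξ‖ ^ 2) ^ s * ‖𝓕 f ξ‖ ^ 2) ^ (1/2 : ℝ)

/-- The homogeneous Sobolev norm `‖f‖_{Ḣ^s} = (∫ |ξ|^{2s} |f̂(ξ)|² dξ)^{1/2}` on ℝ². -/
def homNorm (s : ℝ) (f : Plane → ℂ) : ℝ :=
  (∫ ξ : Plane, ‖ξ‖ ^ (2 * s) * ‖𝓕 f ξ‖ ^ 2) ^ (1/2 : ℝ)

/-- The Fourier transform of a product of Schwartz functions is the convolution of their Fourier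
transforms. -/
lemma fourier_mul_eq_integral (u v : SchwartzMap Plane ℂ) (ξ : Plane) :
    𝓕 (fun x => u x * v x) ξ = ∫ η, 𝓕 (v : Plane → ℂ) η * 𝓕 (u : Plane → ℂ) (ξ - η) := by
  have hinv (w : SchwartzMap Plane ℂ) (x : Plane) :
      𝓕 (𝓕 (w : Plane → ℂ)) x = w (-x) := by
    have h := congrFun (w.continuous.fourierInv_fourier_eq w.integrable
      (by simpa [SchwartzMap.fourier_coe] using (𝓕 w).integrable)) (-x)
    rw [← h, Real.fourierInv_eq_fourier_neg, neg_neg]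
  have h := SchwartzMap.convolution_apply (ContinuousLinearMap.mul ℂ ℂ) (𝓕 v) (𝓕 u) ξ
  rw [convolution_def] at h
  simp only [ContinuousLinearMap.mul_apply', SchwartzMap.fourier_coe] at h
  rw [← h]
  have h2 : SchwartzMap.convolution (ContinuousLinearMap.mul ℂ ℂ) (𝓕 v) (𝓕 u)
      = 𝓕⁻ (SchwartzMap.pairing (ContinuousLinearMap.mul ℂ ℂ) (𝓕 (𝓕 v)) (𝓕 (𝓕 u))) := rfl
  rw [h2, SchwartzMap.fourierInv_coe, Real.fourierInv_eq_fourier_comp_neg]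
  refine congrArg (fun F : Plane → ℂ => 𝓕 F ξ) (funext fun x => ?_)
  simp [SchwartzMap.pairing_apply_apply, SchwartzMap.fourier_coe, hinv, mul_comm]

/-- Cauchy–Schwarz inequality for a function whose square is dominated by a product. -/
lemma sq_lintegral_le_of_sq_le_mul {α : Type*} [MeasurableSpace α] {μ : Measure α}
    {f g h : α → ENNReal} (hf : AEMeasurable f μ) (hg : AEMeasurable g μ)
    (hfg : ∀ᵐ x ∂μ, h x ^ 2 ≤ f x * g x) :
    (∫⁻ x, h x ∂μ) ^ 2 ≤ (∫⁻ x, f x ∂μ) * ∫⁻ x, g x ∂μ := by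
  have key : ∫⁻ x, h x ∂μ ≤ (∫⁻ x, f x ∂μ) ^ (1 / 2 : ℝ) * (∫⁻ x, g x ∂μ) ^ (1 / 2 : ℝ) := by
    calc ∫⁻ x, h x ∂μ ≤ ∫⁻ x, ((fun x => f x ^ (1 / 2 : ℝ)) * fun x => g x ^ (1 / 2 : ℝ)) x ∂μ := by
          refine lintegral_mono_ae ?_
          filter_upwards [hfg] with x hx
          simp only [Pi.mul_apply]
          rw [← ENNReal.mul_rpow_of_nonneg _ _ (by norm_num)]
          calc h x = (h x ^ 2) ^ (1 / 2 : ℝ) := by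
                rw [← ENNReal.rpow_natCast, ← ENNReal.rpow_mul]; norm_num
            _ ≤ _ := by gcongr
      _ ≤ _ := by
          refine (ENNReal.lintegral_mul_le_Lp_mul_Lq μ Real.HolderConjugate.two_two
            (hf.pow_const _) (hg.pow_const _)).trans_eq ?_
          simp only [← ENNReal.rpow_mul]
          norm_num
  calc (∫⁻ x, h x ∂μ) ^ 2
      ≤ ((∫⁻ x, f x ∂μ) ^ (1 / 2 : ℝ) * (∫⁻ x, g x ∂μ) ^ (1 / 2 : ℝ)) ^ 2 := by gcongr
    _ = _ := by
      rw [← ENNReal.mul_rpow_of_nonneg _ _ (by norm_num), ← ENNReal.rpow_natCast,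
        ← ENNReal.rpow_mul]
      norm_num

lemma rpow_neg_mul_rpow_neg_le {A B a b : ℝ} (hA : 0 < A) (hB : 0 < B) (ha : 0 < a) (hb : 0 < b) :
    A ^ (-a) * B ^ (-b) ≤ A ^ (-(a + b)) + B ^ (-(a + b)) := by
  rcases le_total A B with h | h
  · calc A ^ (-a) * B ^ (-b) ≤ A ^ (-a) * A ^ (-b) := by
          gcongr ?_ * ?_
          exact Real.rpow_le_rpow_of_nonpos hA h (by linarith)
      _ = A ^ (-(a + b)) := by rw [← Real.rpow_add hA]; ring_nf
      _ ≤ _ := le_add_of_nonneg_right (by positivity)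
  · calc A ^ (-a) * B ^ (-b) ≤ B ^ (-a) * B ^ (-b) := by
          gcongr ?_ * ?_
          exact Real.rpow_le_rpow_of_nonpos hB h (by linarith)
      _ = B ^ (-(a + b)) := by rw [← Real.rpow_add hB]; ring_nf
      _ ≤ _ := le_add_of_nonneg_left (by positivity)

lemma integrable_one_add_norm_sq_rpow_neg {c : ℝ} (hc : 1 < c) :
    Integrable (fun η : Plane => (1 + ‖η‖ ^ 2) ^ (-c)) := by
  have := integrable_rpow_neg_one_add_norm_sq (E := Plane) (μ := volume) (r := 2 * c)
    (by simp; linarith)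
  simpa [neg_div] using this

lemma integrableOn_ball_norm_rpow_neg {b : ℝ} (hb : b < 1) :
    IntegrableOn (fun η : Plane => ‖η‖ ^ (-(2 * b))) (Metric.ball 0 1) := by
  refine integrableOn_ball_of_norm_le_rpow (C := 1) (α := 2 * b) (by simp) (by simp; linarith)
    (Filter.Eventually.of_forall fun η => ?_) (Measurable.aestronglyMeasurable (by fun_prop))
  rw [Real.norm_of_nonneg (by positivity), one_mul]

/-- The translates of an inhomogeneous weight, paired with a homogeneous one, are uniformly
integrable in the plane. -/
lemma exists_lintegral_weight_le {a b : ℝ} (ha : 0 < a) (hb : 0 < b) (hb1 : b < 1)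
    (hab : 1 < a + b) :
    ∃ K : ENNReal, K ≠ ⊤ ∧ ∀ ξ : Plane,
      ∫⁻ η : Plane, ENNReal.ofReal ((1 + ‖ξ - η‖ ^ 2) ^ (-a) * ‖η‖ ^ (-(2 * b))) ≤ K := by
  set J : Plane → ℝ := fun η => (1 + ‖η‖ ^ 2) ^ (-(a + b)) with hJ
  have hJi : Integrable J := integrable_one_add_norm_sq_rpow_neg hab
  have hJ0 (η : Plane) : 0 ≤ J η := by positivity
  set N : Plane → ℝ := (Metric.ball 0 1).indicator fun η => ‖η‖ ^ (-(2 * b)) with hN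
  have hNi : Integrable N :=
    (integrableOn_ball_norm_rpow_neg hb1).integrable_indicator measurableSet_ball
  have hN0 (η : Plane) : 0 ≤ N η := Set.indicator_nonneg (fun _ _ => by positivity) _
  refine ⟨ENNReal.ofReal ((∫ η, N η) + 2 ^ b * ((∫ η, J η) + ∫ η, J η)), ENNReal.ofReal_ne_top,
    fun ξ => ?_⟩
  have hJξ : Integrable fun η => J (ξ - η) := hJi.comp_sub_left ξ
  have hJs : Integrable fun η => 2 ^ b * (J (ξ - η) + J η) := (hJξ.add hJi).const_mul (2 ^ b)
  have hint : Integrable fun η => N η + 2 ^ b * (J (ξ - η) + J η) := hNi.add hJs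
  have heq : (∫ η, N η) + 2 ^ b * ((∫ η, J η) + ∫ η, J η)
      = ∫ η, N η + 2 ^ b * (J (ξ - η) + J η) := by
    rw [integral_add hNi hJs, integral_const_mul,
      integral_add hJξ hJi, integral_sub_left_eq_self J volume ξ]
  rw [heq, ofReal_integral_eq_lintegral_ofReal hint (Filter.Eventually.of_forall fun η => by
    have := hN0 η; have := hJ0 η; have := hJ0 (ξ - η); positivity)]
  refine lintegral_mono fun η => ENNReal.ofReal_le_ofReal ?_
  have h1 : (1 + ‖ξ - η‖ ^ 2) ^ (-a) ≤ 1 :=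
    Real.rpow_le_one_of_one_le_of_nonpos (by nlinarith [sq_nonneg ‖ξ - η‖]) (by linarith)
  by_cases hη : η ∈ Metric.ball (0 : Plane) 1
  · have hNη : N η = ‖η‖ ^ (-(2 * b)) := Set.indicator_of_mem hη _
    have : 0 ≤ 2 ^ b * (J (ξ - η) + J η) := by
      have := hJ0 η; have := hJ0 (ξ - η); positivity
    rw [hNη]
    have h2 := mul_le_mul_of_nonneg_right h1 (show 0 ≤ ‖η‖ ^ (-(2 * b)) by positivity)
    linarith
  · have h2 : 1 ≤ ‖η‖ := by simpa using hη
    have h3 : ‖η‖ ^ (-(2 * b)) ≤ 2 ^ b * (1 + ‖η‖ ^ 2) ^ (-b) := by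
      calc ‖η‖ ^ (-(2 * b)) = (‖η‖ ^ 2) ^ (-b) := by
            rw [← Real.rpow_natCast, ← Real.rpow_mul (norm_nonneg _)]; norm_num
        _ ≤ ((1 + ‖η‖ ^ 2) / 2) ^ (-b) :=
            Real.rpow_le_rpow_of_nonpos (by positivity) (by nlinarith) (by linarith)
        _ = 2 ^ b * (1 + ‖η‖ ^ 2) ^ (-b) := by
            rw [Real.div_rpow (by positivity) (by norm_num), Real.rpow_neg (by norm_num : (0:ℝ) ≤ 2),
              div_inv_eq_mul, mul_comm]
    calc (1 + ‖ξ - η‖ ^ 2) ^ (-a) * ‖η‖ ^ (-(2 * b))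
        ≤ (1 + ‖ξ - η‖ ^ 2) ^ (-a) * (2 ^ b * (1 + ‖η‖ ^ 2) ^ (-b)) := by gcongr
      _ = 2 ^ b * ((1 + ‖ξ - η‖ ^ 2) ^ (-a) * (1 + ‖η‖ ^ 2) ^ (-b)) := by ring
      _ ≤ 2 ^ b * (J (ξ - η) + J η) := by
          gcongr
          exact rpow_neg_mul_rpow_neg_le (by positivity) (by positivity) ha hb
      _ ≤ _ := le_add_of_nonneg_left (hN0 η)

lemma one_add_norm_sq_rpow_le {t : ℝ} (ht : 0 ≤ t) (ht1 : t ≤ 1) (ξ η : Plane) :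
    (1 + ‖ξ‖ ^ 2) ^ t ≤ 2 * ((1 + ‖ξ - η‖ ^ 2) ^ t + ‖η‖ ^ (2 * t)) := by
  have h1 : 1 + ‖ξ‖ ^ 2 ≤ 2 * ((1 + ‖ξ - η‖ ^ 2) + ‖η‖ ^ 2) := by
    have h : ‖ξ‖ ≤ ‖ξ - η‖ + ‖η‖ := by simpa using norm_add_le (ξ - η) η
    nlinarith [sq_nonneg (‖ξ - η‖ - ‖η‖), norm_nonneg ξ]
  calc (1 + ‖ξ‖ ^ 2) ^ t ≤ (2 * ((1 + ‖ξ - η‖ ^ 2) + ‖η‖ ^ 2)) ^ t := by gcongr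
    _ = 2 ^ t * ((1 + ‖ξ - η‖ ^ 2) + ‖η‖ ^ 2) ^ t :=
        Real.mul_rpow (by norm_num) (by positivity)
    _ ≤ 2 * ((1 + ‖ξ - η‖ ^ 2) ^ t + (‖η‖ ^ 2) ^ t) := by
        gcongr
        · simpa using Real.rpow_le_rpow_of_exponent_le (by norm_num : (1 : ℝ) ≤ 2) ht1
        · exact Real.rpow_add_le_add_rpow (by positivity) (by positivity) ht ht1
    _ = _ := by
        rw [← Real.rpow_natCast ‖η‖, ← Real.rpow_mul (norm_nonneg _)]; norm_num

/-- The kernel of the product estimate has uniformly bounded mass. -/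
lemma exists_lintegral_kernel_le {s σ : ℝ} (hs1 : s ≤ 1) (hσ : 0 < σ)
    (hσ1 : σ < 2 * s - 1) :
    ∃ K : ENNReal, K ≠ ⊤ ∧ ∀ ξ : Plane, ENNReal.ofReal ((1 + ‖ξ‖ ^ 2) ^ (1 - s)) *
      ∫⁻ η : Plane, ENNReal.ofReal ((1 + ‖ξ - η‖ ^ 2) ^ (-s) * ‖η‖ ^ (-(2 * (1 - σ)))) ≤ K := by
  obtain ⟨K₁, hK₁, h₁⟩ := exists_lintegral_weight_le (a := 2 * s - 1) (b := 1 - σ)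
    (by linarith) (by linarith) (by linarith) (by linarith)
  obtain ⟨K₂, hK₂, h₂⟩ := exists_lintegral_weight_le (a := s) (b := s - σ)
    (by linarith) (by linarith) (by linarith) (by linarith)
  refine ⟨ENNReal.ofReal 2 * (K₁ + K₂), by finiteness, fun ξ => ?_⟩
  rw [← lintegral_const_mul' _ _ ENNReal.ofReal_ne_top]
  calc _ ≤ ∫⁻ η : Plane, ENNReal.ofReal 2 *
        (ENNReal.ofReal ((1 + ‖ξ - η‖ ^ 2) ^ (-(2 * s - 1)) * ‖η‖ ^ (-(2 * (1 - σ)))) +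
          ENNReal.ofReal ((1 + ‖ξ - η‖ ^ 2) ^ (-s) * ‖η‖ ^ (-(2 * (s - σ))))) := by
        refine lintegral_mono_ae ?_
        filter_upwards [Measure.ae_ne volume (0 : Plane)] with η hη
        have hη0 : 0 < ‖η‖ := norm_pos_iff.mpr hη
        have hA : 0 < 1 + ‖ξ - η‖ ^ 2 := by positivity
        rw [← ENNReal.ofReal_mul (by positivity), ← ENNReal.ofReal_add (by positivity)
          (by positivity), ← ENNReal.ofReal_mul (by norm_num)]
        refine ENNReal.ofReal_le_ofReal ?_
        have e₁ : (1 + ‖ξ - η‖ ^ 2) ^ (-(2 * s - 1))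
            = (1 + ‖ξ - η‖ ^ 2) ^ (1 - s) * (1 + ‖ξ - η‖ ^ 2) ^ (-s) := by
          rw [← Real.rpow_add hA]; ring_nf
        have e₂ : ‖η‖ ^ (-(2 * (s - σ))) = ‖η‖ ^ (2 * (1 - s)) * ‖η‖ ^ (-(2 * (1 - σ))) := by
          rw [← Real.rpow_add hη0]; ring_nf
        rw [e₁, e₂]
        calc _ ≤ (2 * ((1 + ‖ξ - η‖ ^ 2) ^ (1 - s) + ‖η‖ ^ (2 * (1 - s)))) *
              ((1 + ‖ξ - η‖ ^ 2) ^ (-s) * ‖η‖ ^ (-(2 * (1 - σ)))) := by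
              gcongr
              exact one_add_norm_sq_rpow_le (by linarith) (by linarith) ξ η
          _ = _ := by ring
    _ ≤ ENNReal.ofReal 2 * (K₁ + K₂) := by
        rw [lintegral_const_mul' _ _ ENNReal.ofReal_ne_top, lintegral_add_left (by fun_prop)]
        gcongr
        · exact h₁ ξ
        · exact h₂ ξ

lemma SchwartzMap.integrable_weight_mul_norm_sq (f : SchwartzMap Plane ℂ) {w : Plane → ℝ}
    (hw : Measurable w) (hw0 : ∀ ξ, 0 ≤ w ξ) (hw1 : ∀ ξ, w ξ ≤ 1 + ‖ξ‖ ^ 2) :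
    Integrable fun ξ => w ξ * ‖f ξ‖ ^ 2 := by
  obtain ⟨C, hC⟩ : ∃ C, ∀ ξ, ‖f ξ‖ ≤ C := ⟨_, SchwartzMap.norm_le_seminorm ℝ f⟩
  have hi : Integrable fun ξ => C * (‖f ξ‖ + ‖ξ‖ ^ 2 * ‖f ξ‖) :=
    (f.integrable.norm.add (f.integrable_pow_mul volume 2)).const_mul C
  refine hi.mono' (hw.mul (f.continuous.norm.measurable.pow_const 2)).aestronglyMeasurable
    (Filter.Eventually.of_forall fun ξ => ?_)
  rw [Real.norm_of_nonneg (mul_nonneg (hw0 ξ) (by positivity))]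
  calc w ξ * ‖f ξ‖ ^ 2 ≤ (1 + ‖ξ‖ ^ 2) * (C * ‖f ξ‖) := by
        rw [sq ‖f ξ‖]
        gcongr
        exacts [hw1 ξ, hC ξ]
    _ = _ := by ring

/-- The squared form of the product estimate, for arbitrary measurable frequency profiles. -/
lemma lintegral_weight_mul_sq_convolution_le {s σ : ℝ} {K : ENNReal}
    (hK : ∀ ξ : Plane, ENNReal.ofReal ((1 + ‖ξ‖ ^ 2) ^ (1 - s)) *
      ∫⁻ η : Plane, ENNReal.ofReal ((1 + ‖ξ - η‖ ^ 2) ^ (-s) * ‖η‖ ^ (-(2 * (1 - σ)))) ≤ K)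
    {f g : Plane → ℂ} (hf : Measurable f) (hg : Measurable g) :
    ∫⁻ ξ, ENNReal.ofReal ((1 + ‖ξ‖ ^ 2) ^ (1 - s) * ‖∫ η, g η * f (ξ - η)‖ ^ 2) ≤
      K * ((∫⁻ ξ, ENNReal.ofReal ((1 + ‖ξ‖ ^ 2) ^ s * ‖f ξ‖ ^ 2)) *
        ∫⁻ ξ, ENNReal.ofReal (‖ξ‖ ^ (2 * (1 - σ)) * ‖g ξ‖ ^ 2)) := by
  set F : Plane → ENNReal := fun ξ => ENNReal.ofReal ((1 + ‖ξ‖ ^ 2) ^ s * ‖f ξ‖ ^ 2) with hF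
  set G : Plane → ENNReal := fun ξ => ENNReal.ofReal (‖ξ‖ ^ (2 * (1 - σ)) * ‖g ξ‖ ^ 2) with hG
  have hFm : Measurable F := by fun_prop
  have hGm : Measurable G := by fun_prop
  have hpt (ξ : Plane) :
      ENNReal.ofReal ((1 + ‖ξ‖ ^ 2) ^ (1 - s) * ‖∫ η, g η * f (ξ - η)‖ ^ 2) ≤
        K * ∫⁻ η, F (ξ - η) * G η := by
    have hcs := sq_lintegral_le_of_sq_le_mul (μ := volume)
      (f := fun η : Plane => ENNReal.ofReal ((1 + ‖ξ - η‖ ^ 2) ^ (-s) * ‖η‖ ^ (-(2 * (1 - σ)))))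
      (g := fun η => F (ξ - η) * G η) (h := fun η => ‖g η * f (ξ - η)‖ₑ)
      (by fun_prop) (by fun_prop) (by
        filter_upwards [Measure.ae_ne volume (0 : Plane)] with η hη
        have hη0 : 0 < ‖η‖ := norm_pos_iff.mpr hη
        have hA : 0 < 1 + ‖ξ - η‖ ^ 2 := by positivity
        rw [← ofReal_norm, ← ENNReal.ofReal_pow (norm_nonneg _), hF, hG,
          ← ENNReal.ofReal_mul (by positivity), ← ENNReal.ofReal_mul (by positivity)]
        refine ENNReal.ofReal_le_ofReal (le_of_eq ?_)
        rw [Real.rpow_neg hA.le, Real.rpow_neg hη0.le, norm_mul]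
        have := (Real.rpow_pos_of_pos hA s).ne'
        have := (Real.rpow_pos_of_pos hη0 (2 * (1 - σ))).ne'
        field_simp)
    calc ENNReal.ofReal ((1 + ‖ξ‖ ^ 2) ^ (1 - s) * ‖∫ η, g η * f (ξ - η)‖ ^ 2)
        = ENNReal.ofReal ((1 + ‖ξ‖ ^ 2) ^ (1 - s)) * ‖∫ η, g η * f (ξ - η)‖ₑ ^ 2 := by
          rw [ENNReal.ofReal_mul (by positivity), ENNReal.ofReal_pow (norm_nonneg _),
            ofReal_norm]
      _ ≤ ENNReal.ofReal ((1 + ‖ξ‖ ^ 2) ^ (1 - s)) * (∫⁻ η, ‖g η * f (ξ - η)‖ₑ) ^ 2 := by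
          gcongr
          exact enorm_integral_le_lintegral_enorm _
      _ ≤ ENNReal.ofReal ((1 + ‖ξ‖ ^ 2) ^ (1 - s)) * (_ * _) := by gcongr
      _ ≤ _ := by
          rw [← mul_assoc]
          gcongr
          exact hK ξ
  calc _ ≤ ∫⁻ ξ, K * ∫⁻ η, F (ξ - η) * G η := lintegral_mono hpt
    _ = K * ∫⁻ ξ, ∫⁻ η, F (ξ - η) * G η :=
        lintegral_const_mul _ (Measurable.lintegral_prod_right' (f := fun p : Plane × Plane =>
          F (p.1 - p.2) * G p.2) (by fun_prop))
    _ = K * ∫⁻ η, ∫⁻ ξ, F (ξ - η) * G η := by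
        rw [lintegral_lintegral_swap (by fun_prop)]
    _ = K * ((∫⁻ ξ, F ξ) * ∫⁻ ξ, G ξ) := by
        congr 1
        rw [← lintegral_const_mul _ hGm]
        refine lintegral_congr fun η => ?_
        rw [lintegral_mul_const _ (by fun_prop), lintegral_sub_right_eq_self F η]

lemma integral_le_toReal_lintegral_ofReal {α : Type*} [MeasurableSpace α] {μ : Measure α}
    (f : α → ℝ) (hf : ∀ x, 0 ≤ f x) :
    ∫ x, f x ∂μ ≤ (∫⁻ x, ENNReal.ofReal (f x) ∂μ).toReal := by
  by_cases h : Integrable f μ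
  · exact (integral_eq_lintegral_of_nonneg_ae (Filter.Eventually.of_forall hf) h.1).le
  · rw [integral_undef h]
    positivity

theorem product_estimate_Hs_homogeneous (s σ : ℝ)
    (hs : 1/2 < s) (hs1 : s ≤ 1) (hσ : 0 < σ) (hσ1 : σ < 2 * s - 1) :
    ∃ C > 0, ∀ u v : SchwartzMap Plane ℂ,
      sobNorm (1 - s) (fun x => u x * v x) ≤
        C * sobNorm s (fun x => u x) * homNorm (1 - σ) (fun x => v x) := by
  obtain ⟨K, hKt, hK⟩ := exists_lintegral_kernel_le hs1 hσ hσ1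
  refine ⟨(K.toReal + 1) ^ (1 / 2 : ℝ), by positivity, fun u v => ?_⟩
  have hu : Integrable fun ξ : Plane => (1 + ‖ξ‖ ^ 2) ^ s * ‖𝓕 (u : Plane → ℂ) ξ‖ ^ 2 := by
    have := (𝓕 u).integrable_weight_mul_norm_sq (w := fun ξ => (1 + ‖ξ‖ ^ 2) ^ s) (by fun_prop)
      (fun ξ => by positivity) (fun ξ => by
        simpa using Real.rpow_le_rpow_of_exponent_le
          (by nlinarith [sq_nonneg ‖ξ‖] : 1 ≤ 1 + ‖ξ‖ ^ 2) hs1)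
    simpa only [SchwartzMap.fourier_coe] using this
  have hv : Integrable fun ξ : Plane => ‖ξ‖ ^ (2 * (1 - σ)) * ‖𝓕 (v : Plane → ℂ) ξ‖ ^ 2 := by
    have := (𝓕 v).integrable_weight_mul_norm_sq (w := fun ξ => ‖ξ‖ ^ (2 * (1 - σ))) (by fun_prop)
      (fun ξ => by positivity) (fun ξ => by
        rw [Real.rpow_mul (norm_nonneg _), Real.rpow_two]
        calc (‖ξ‖ ^ 2) ^ (1 - σ) ≤ (1 + ‖ξ‖ ^ 2) ^ (1 - σ) :=
              Real.rpow_le_rpow (by positivity) (by linarith) (by linarith)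
          _ ≤ 1 + ‖ξ‖ ^ 2 := by
              simpa using Real.rpow_le_rpow_of_exponent_le
                (by nlinarith [sq_nonneg ‖ξ‖] : 1 ≤ 1 + ‖ξ‖ ^ 2) (by linarith : 1 - σ ≤ 1))
    simpa only [SchwartzMap.fourier_coe] using this
  have hm (w : SchwartzMap Plane ℂ) : Measurable (𝓕 (w : Plane → ℂ)) := by
    rw [← SchwartzMap.fourier_coe]
    exact (𝓕 w).continuous.measurable
  have key := lintegral_weight_mul_sq_convolution_le hK (hm u) (hm v)
  simp only [← fourier_mul_eq_integral] at key
  rw [← ofReal_integral_eq_lintegral_ofReal hu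
      (Filter.Eventually.of_forall fun ξ => by positivity),
    ← ofReal_integral_eq_lintegral_ofReal hv
      (Filter.Eventually.of_forall fun ξ => by positivity)] at key
  have hIu : 0 ≤ ∫ ξ : Plane, (1 + ‖ξ‖ ^ 2) ^ s * ‖𝓕 (u : Plane → ℂ) ξ‖ ^ 2 :=
    integral_nonneg fun ξ => by positivity
  have hIv : 0 ≤ ∫ ξ : Plane, ‖ξ‖ ^ (2 * (1 - σ)) * ‖𝓕 (v : Plane → ℂ) ξ‖ ^ 2 :=
    integral_nonneg fun ξ => by positivity
  have hle : ∫ ξ : Plane, (1 + ‖ξ‖ ^ 2) ^ (1 - s) * ‖𝓕 (fun x => u x * v x) ξ‖ ^ 2 ≤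
      (K.toReal + 1) * (∫ ξ : Plane, (1 + ‖ξ‖ ^ 2) ^ s * ‖𝓕 (u : Plane → ℂ) ξ‖ ^ 2) *
        ∫ ξ : Plane, ‖ξ‖ ^ (2 * (1 - σ)) * ‖𝓕 (v : Plane → ℂ) ξ‖ ^ 2 := by
    have hle' := (integral_le_toReal_lintegral_ofReal
      (fun ξ : Plane => (1 + ‖ξ‖ ^ 2) ^ (1 - s) * ‖𝓕 (fun x => u x * v x) ξ‖ ^ 2)
      (fun ξ => by positivity)).trans
        (ENNReal.toReal_mono (by finiteness) key)
    rw [ENNReal.toReal_mul, ENNReal.toReal_mul, ENNReal.toReal_ofReal hIu,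
      ENNReal.toReal_ofReal hIv] at hle'
    nlinarith [mul_nonneg hIu hIv]
  simp only [sobNorm, homNorm]
  rw [← Real.mul_rpow (by positivity) hIu, ← Real.mul_rpow (by positivity) hIv]
  exact Real.rpow_le_rpow (integral_nonneg fun ξ => by positivity) hle (by norm_num)

end
end

section
/- Let 1/2 < s ≤ 1, 1/4 < s' ≤ 1, and 0 < σ < 2s − 1. Then there exists a constant C > 0 such that for all Schwartz functions u, v, w on ℝ², ‖uvw‖_{Ḣ^{σ−1}} ≤ C ‖u‖_{H^s} ‖v‖_{H^s} ‖w‖_{H^{s'}}. -/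
open MeasureTheory Real
open scoped FourierTransform

noncomputable section

open scoped ENNReal SchwartzMap

/-- The Cauchy–Schwarz inequality for lower Lebesgue integrals, in squared form. -/
lemma sq_lintegral_mul_le {α : Type*} [MeasurableSpace α] {μ : Measure α} {f g : α → ℝ≥0∞}
    (hf : AEMeasurable f μ) (hg : AEMeasurable g μ) :
    (∫⁻ x, f x * g x ∂μ) ^ 2 ≤ (∫⁻ x, f x ^ 2 ∂μ) * ∫⁻ x, g x ^ 2 ∂μ := by
  have h := ENNReal.lintegral_mul_le_Lp_mul_Lq μ Real.HolderConjugate.two_two hf hg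
  simp only [Pi.mul_apply, ENNReal.rpow_ofNat] at h
  have key (c : ℝ≥0∞) : (c ^ (1 / 2 : ℝ)) ^ 2 = c := by
    rw [← ENNReal.rpow_natCast, ← ENNReal.rpow_mul]
    norm_num
  calc _ ≤ _ := pow_le_pow_left' h 2
    _ = _ := by rw [mul_pow, key, key]

section Young

variable {f g : Plane → ℝ≥0∞}

/-- Jensen's inequality for the square of a convolution. -/
lemma sq_lconvolution_le (hf : Measurable f) (hg : Measurable g) (x : Plane) :
    ((f ⋆ₗ[volume] g) x) ^ 2 ≤ (∫⁻ y, f y) * (f ⋆ₗ[volume] fun y => g y ^ 2) x := by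
  have key (c : ℝ≥0∞) : (c ^ (1 / 2 : ℝ)) ^ 2 = c := by
    rw [← ENNReal.rpow_natCast, ← ENNReal.rpow_mul]
    norm_num
  have hr : Measurable fun y => f y ^ (1 / 2 : ℝ) := hf.pow_const _
  have h := sq_lintegral_mul_le (μ := volume) (f := fun y => f y ^ (1 / 2 : ℝ))
    (g := fun y => f y ^ (1 / 2 : ℝ) * g (-y + x)) hr.aemeasurable
    (by fun_prop)
  simpa only [lconvolution_def, ← mul_assoc, mul_pow, key, ← pow_two] using h

/-- Young's inequality `L¹ ⋆ L² ⊆ L²`. -/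
lemma lintegral_sq_lconvolution_le (hf : Measurable f) (hg : Measurable g) :
    ∫⁻ x, ((f ⋆ₗ[volume] g) x) ^ 2 ≤ (∫⁻ y, f y) ^ 2 * ∫⁻ y, g y ^ 2 := by
  calc _ ≤ ∫⁻ x, (∫⁻ y, f y) * (f ⋆ₗ[volume] fun y => g y ^ 2) x :=
        lintegral_mono fun x => sq_lconvolution_le hf hg x
    _ = (∫⁻ y, f y) * ∫⁻ x, ∫⁻ y, f y * g (-y + x) ^ 2 := by
        rw [lintegral_const_mul _ (measurable_lconvolution _ hf (hg.pow_const 2))]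
        simp only [lconvolution_def]
    _ = (∫⁻ y, f y) * ∫⁻ y, ∫⁻ x, f y * g (-y + x) ^ 2 := by
        rw [lintegral_lintegral_swap]
        fun_prop
    _ = (∫⁻ y, f y) * ∫⁻ y, f y * ∫⁻ x, g x ^ 2 := by
        congr 2
        ext y
        rw [lintegral_const_mul _ (by fun_prop),
          lintegral_add_left_eq_self (fun x => g x ^ 2) (-y)]
    _ = _ := by
        rw [lintegral_mul_const _ hf]
        ring

/-- Young's inequality `L² ⋆ L² ⊆ L^∞`. -/
lemma sq_lconvolution_le_mul (hf : Measurable f) (hg : Measurable g) (x : Plane) :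
    ((f ⋆ₗ[volume] g) x) ^ 2 ≤ (∫⁻ y, f y ^ 2) * ∫⁻ y, g y ^ 2 := by
  have h := sq_lintegral_mul_le (μ := volume) (f := f) (g := fun y => g (-y + x))
    hf.aemeasurable (by fun_prop)
  rwa [lintegral_neg_eq_self (μ := volume) (fun y => g (y + x) ^ 2),
    lintegral_add_right_eq_self (fun y => g y ^ 2) x] at h

/-- Young's inequality `L¹ ⋆ L^∞ ⊆ L^∞`. -/
lemma sq_lconvolution_le_of_sq_le (hf : Measurable f) (hg : Measurable g) {K : ℝ≥0∞}
    (hK : ∀ y, g y ^ 2 ≤ K) (x : Plane) :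
    ((f ⋆ₗ[volume] g) x) ^ 2 ≤ (∫⁻ y, f y) ^ 2 * K := by
  refine (sq_lconvolution_le hf hg x).trans ?_
  rw [pow_two, mul_assoc, ← lintegral_mul_const K hf, lconvolution_def]
  exact mul_le_mul_right (lintegral_mono fun y => mul_le_mul_right (hK _) _) _

end Young

lemma add_add_sq_le (a b c : ℝ≥0∞) : (a + b + c) ^ 2 ≤ 3 * (a ^ 2 + b ^ 2 + c ^ 2) := by
  by_cases h : a = ∞ ∨ b = ∞ ∨ c = ∞
  · have : 3 * (a ^ 2 + b ^ 2 + c ^ 2) = ∞ := by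
      rcases h with rfl | rfl | rfl <;> simp [ENNReal.mul_top]
    simp [this]
  · push Not at h
    lift a to NNReal using h.1
    lift b to NNReal using h.2.1
    lift c to NNReal using h.2.2
    norm_cast
    rw [← NNReal.coe_le_coe]
    push_cast
    nlinarith [sq_nonneg ((a : ℝ) - b), sq_nonneg ((b : ℝ) - c), sq_nonneg ((a : ℝ) - c)]

/-- The trilinear estimate behind `cubic_estimate_B0`, for nonnegative functions: `W` is the
weight of the output, `M` and `m` are square integrable weights, and `p` is the weight of the first
two inputs. -/
lemma lintegral_sq_weight_mul_lconvolution_le {W M m p F G H : Plane → ℝ≥0∞}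
    (hM : Measurable M) (hm : Measurable m) (hp : Measurable p)
    (hF : Measurable F) (hG : Measurable G) (hH : Measurable H)
    (hW : ∀ᵐ x, ∀ y z, W x ≤ p y * p z * (M x * (m y + m z) + m y * m z)) :
    ∫⁻ x, (W x * (F ⋆ₗ[volume] (G ⋆ₗ[volume] H)) x) ^ 2 ≤
      3 * ((∫⁻ x, m x ^ 2) ^ 2 + 2 * ((∫⁻ x, M x ^ 2) * ∫⁻ x, m x ^ 2)) *
        ((∫⁻ x, (p x * F x) ^ 2) * (∫⁻ x, (p x * G x) ^ 2) * ∫⁻ x, H x ^ 2) := by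
  set f : Plane → ℝ≥0∞ := fun x => p x * F x with hf_def
  set g : Plane → ℝ≥0∞ := fun x => p x * G x with hg_def
  have hf : Measurable f := hp.mul hF
  have hg : Measurable g := hp.mul hG
  set mf : Plane → ℝ≥0∞ := fun x => m x * f x with hmf_def
  set mg : Plane → ℝ≥0∞ := fun x => m x * g x with hmg_def
  have hmf : Measurable mf := hm.mul hf
  have hmg : Measurable mg := hm.mul hg
  have hmgH := measurable_lconvolution (volume : Measure Plane) hmg hH
  have hgH := measurable_lconvolution (volume : Measure Plane) hg hH
  have hGH := measurable_lconvolution (volume : Measure Plane) hG hH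
  have hA := measurable_lconvolution (volume : Measure Plane) hmf hmgH
  have hB := measurable_lconvolution (volume : Measure Plane) hmf hgH
  have hC := measurable_lconvolution (volume : Measure Plane) hf hmgH
  set A := mf ⋆ₗ[volume] (mg ⋆ₗ[volume] H) with hA_def
  set B := mf ⋆ₗ[volume] (g ⋆ₗ[volume] H) with hB_def
  set C := f ⋆ₗ[volume] (mg ⋆ₗ[volume] H) with hC_def
  have pointwise : ∀ᵐ x, W x * (F ⋆ₗ[volume] (G ⋆ₗ[volume] H)) x ≤ A x + M x * B x + M x * C x := by
    filter_upwards [hW] with x hx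
    have expand (P Q : Plane → ℝ≥0∞) (hP : Measurable P) (hQ : Measurable Q) :
        (P ⋆ₗ[volume] (Q ⋆ₗ[volume] H)) x =
          ∫⁻ y, ∫⁻ z, P y * (Q z * H (-z + (-y + x))) := by
      simp only [lconvolution_def]
      congr 1
      ext y
      rw [lintegral_const_mul _ (by fun_prop)]
    rw [hA_def, hB_def, hC_def, expand F G hF hG, expand mf mg hmf hmg, expand mf g hmf hg,
      expand f mg hf hmg, ← lintegral_const_mul _ (by fun_prop), ← lintegral_const_mul _ (by fun_prop),
      ← lintegral_const_mul _ (by fun_prop), ← lintegral_add_left (by fun_prop),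
      ← lintegral_add_left (by fun_prop)]
    refine lintegral_mono fun y => ?_
    rw [← lintegral_const_mul _ (by fun_prop), ← lintegral_const_mul _ (by fun_prop),
      ← lintegral_const_mul _ (by fun_prop), ← lintegral_add_left (by fun_prop),
      ← lintegral_add_left (by fun_prop)]
    refine lintegral_mono fun z => ?_
    calc _ ≤ p y * p z * (M x * (m y + m z) + m y * m z) *
          (F y * (G z * H (-z + (-y + x)))) := by gcongr; exact hx y z
      _ = _ := by simp only [hmf_def, hmg_def, hf_def, hg_def]; ring
  have hmf1 : (∫⁻ x, mf x) ^ 2 ≤ (∫⁻ x, m x ^ 2) * ∫⁻ x, f x ^ 2 :=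
    sq_lintegral_mul_le hm.aemeasurable hf.aemeasurable
  have hmg1 : (∫⁻ x, mg x) ^ 2 ≤ (∫⁻ x, m x ^ 2) * ∫⁻ x, g x ^ 2 :=
    sq_lintegral_mul_le hm.aemeasurable hg.aemeasurable
  set Im := ∫⁻ x, m x ^ 2
  set IM := ∫⁻ x, M x ^ 2 with hIM
  set If := ∫⁻ x, f x ^ 2
  set Ig := ∫⁻ x, g x ^ 2
  set IH := ∫⁻ x, H x ^ 2
  have hmgH2 : ∫⁻ x, ((mg ⋆ₗ[volume] H) x) ^ 2 ≤ Im * Ig * IH :=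
    (lintegral_sq_lconvolution_le hmg hH).trans (by gcongr)
  have boundA : ∫⁻ x, A x ^ 2 ≤ Im ^ 2 * (If * Ig * IH) := by
    calc _ ≤ (∫⁻ x, mf x) ^ 2 * ∫⁻ x, ((mg ⋆ₗ[volume] H) x) ^ 2 :=
          lintegral_sq_lconvolution_le hmf hmgH
      _ ≤ (Im * If) * (Im * Ig * IH) := by gcongr
      _ = _ := by ring
  have sup {D : Plane → ℝ≥0∞} {K : ℝ≥0∞} (hD : ∀ x, D x ^ 2 ≤ K) :
      ∫⁻ x, (M x * D x) ^ 2 ≤ IM * K := by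
    rw [hIM, ← lintegral_mul_const _ (by fun_prop)]
    refine lintegral_mono fun x => ?_
    rw [mul_pow]
    gcongr
    exact hD x
  have boundB : ∫⁻ x, (M x * B x) ^ 2 ≤ IM * (Im * (If * Ig * IH)) := by
    refine sup fun x => ?_
    calc _ ≤ (∫⁻ x, mf x) ^ 2 * (Ig * IH) :=
          sq_lconvolution_le_of_sq_le hmf hgH (sq_lconvolution_le_mul hg hH) x
      _ ≤ (Im * If) * (Ig * IH) := by gcongr
      _ = _ := by ring
  have boundC : ∫⁻ x, (M x * C x) ^ 2 ≤ IM * (Im * (If * Ig * IH)) := by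
    refine sup fun x => ?_
    calc _ ≤ If * ∫⁻ x, ((mg ⋆ₗ[volume] H) x) ^ 2 := sq_lconvolution_le_mul hf hmgH x
      _ ≤ If * (Im * Ig * IH) := by gcongr
      _ = _ := by ring
  calc _ ≤ ∫⁻ x, 3 * (A x ^ 2 + (M x * B x) ^ 2 + (M x * C x) ^ 2) := by
        refine lintegral_mono_ae ?_
        filter_upwards [pointwise] with x hx
        exact (pow_le_pow_left' hx 2).trans (add_add_sq_le _ _ _)
    _ = 3 * ((∫⁻ x, A x ^ 2) + (∫⁻ x, (M x * B x) ^ 2) + ∫⁻ x, (M x * C x) ^ 2) := by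
        rw [lintegral_const_mul _ (by fun_prop), lintegral_add_left (by fun_prop),
          lintegral_add_left (by fun_prop)]
    _ ≤ 3 * (Im ^ 2 * (If * Ig * IH) + IM * (Im * (If * Ig * IH)) +
          IM * (Im * (If * Ig * IH))) := by gcongr
    _ = _ := by ring

/-- The Fourier transform of a product is dominated by the convolution of the Fourier transforms. -/
lemma enorm_fourier_mul_le (u v : 𝓢(Plane, ℂ)) (ξ : Plane) :
    ‖𝓕 (fun x => u x * v x) ξ‖ₑ ≤
      ((fun η => ‖𝓕 (fun x => u x) η‖ₑ) ⋆ₗ[volume] fun η => ‖𝓕 (fun x => v x) η‖ₑ) ξ := by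
  have h : SchwartzMap.convolution (ContinuousLinearMap.mul ℂ ℂ) (𝓕 u) (𝓕 v) =
      𝓕 (SchwartzMap.pairing (ContinuousLinearMap.mul ℂ ℂ) u v) := by
    have h1 : 𝓕⁻ (SchwartzMap.convolution (ContinuousLinearMap.mul ℂ ℂ) (𝓕 u) (𝓕 v)) =
        SchwartzMap.pairing (ContinuousLinearMap.mul ℂ ℂ) u v := by
      ext x
      have e (w : 𝓢(Plane, ℂ)) : 𝓕 w (-x) = 𝓕⁻ w x := by
        rw [SchwartzMap.fourierInv_coe, SchwartzMap.fourier_coe, Real.fourierInv_eq_fourier_neg]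
      rw [← e, SchwartzMap.fourier_convolution]
      simp [e]
    rw [← h1]
    simp
  have h2 : 𝓕 (fun x => u x * v x) ξ = ∫ η, 𝓕 u η * 𝓕 v (ξ - η) := by
    have := congrArg (fun w : 𝓢(Plane, ℂ) => w ξ) h
    simp only [SchwartzMap.convolution_apply, SchwartzMap.fourier_coe] at this
    exact this.symm
  rw [h2, lconvolution_def]
  refine (enorm_integral_le_lintegral_enorm _).trans (le_of_eq ?_)
  refine lintegral_congr fun η => ?_
  rw [enorm_mul, SchwartzMap.fourier_coe, SchwartzMap.fourier_coe, sub_eq_neg_add]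

/-- The power weight `r ^ (-a)` near the origin, `r ^ (-b)` at infinity. -/
def brokenPower (a b r : ℝ) : ℝ := if r ≤ 1 then r ^ (-a) else r ^ (-b)

lemma measurable_brokenPower (a b : ℝ) : Measurable (brokenPower a b) :=
  Measurable.ite measurableSet_Iic (by fun_prop) (by fun_prop)

lemma brokenPower_nonneg (a b : ℝ) {r : ℝ} (hr : 0 ≤ r) : 0 ≤ brokenPower a b r := by
  unfold brokenPower
  split_ifs <;> positivity

lemma rpow_neg_le_brokenPower {a b s x y z : ℝ} (hx : 0 < x) (hy : 1 ≤ y) (hz : 1 ≤ z)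
    (hab : a ≤ b) (hsb : s ≤ b) (hs : 0 ≤ s) (h : a + 2 * s = 2 * b) :
    x ^ (-a) ≤ y ^ s * z ^ s *
      (brokenPower a b x * (y ^ (-b) + z ^ (-b)) + y ^ (-b) * z ^ (-b)) := by
  wlog hyz : y ≤ z generalizing y z
  · refine (this hz hy (le_of_not_ge hyz)).trans (le_of_eq ?_)
    ring
  have hy0 : 0 < y := by linarith
  have hz0 : 0 < z := by linarith
  have ly : 0 ≤ log y := log_nonneg hy
  have lyz : log y ≤ log z := log_le_log hy0 hyz
  unfold brokenPower
  split_ifs with hx1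
  · have h1 : 1 ≤ y ^ s * z ^ s * y ^ (-b) := by
      simp only [rpow_def_of_pos hy0, rpow_def_of_pos hz0, ← exp_add]
      rw [Real.one_le_exp_iff]
      nlinarith
    have h2 : 0 ≤ y ^ s * z ^ s * (x ^ (-a) * z ^ (-b) + y ^ (-b) * z ^ (-b)) := by positivity
    have h3 : x ^ (-a) * 1 ≤ x ^ (-a) * (y ^ s * z ^ s * y ^ (-b)) := by gcongr
    nlinarith
  · push Not at hx1
    have lx : 0 ≤ log x := log_nonneg hx1.le
    rcases le_total x z with hxz | hxz
    · have lxz : log x ≤ log z := log_le_log hx hxz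
      have h1 : x ^ (-a) ≤ y ^ s * z ^ s * (x ^ (-b) * y ^ (-b)) := by
        simp only [rpow_def_of_pos hx, rpow_def_of_pos hy0, rpow_def_of_pos hz0, ← exp_add]
        rw [exp_le_exp]
        nlinarith [mul_nonneg (sub_nonneg.2 hab) (sub_nonneg.2 lxz),
          mul_nonneg (sub_nonneg.2 hsb) (sub_nonneg.2 lyz)]
      have h2 : 0 ≤ y ^ s * z ^ s * (x ^ (-b) * z ^ (-b) + y ^ (-b) * z ^ (-b)) := by positivity
      nlinarith
    · have lxz : log z ≤ log x := log_le_log hz0 hxz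
      have h1 : x ^ (-a) ≤ y ^ s * z ^ s * (y ^ (-b) * z ^ (-b)) := by
        simp only [rpow_def_of_pos hx, rpow_def_of_pos hy0, rpow_def_of_pos hz0, ← exp_add]
        rw [exp_le_exp]
        nlinarith [mul_nonneg (sub_nonneg.2 hsb) (sub_nonneg.2 lxz),
          mul_nonneg (sub_nonneg.2 hsb) (sub_nonneg.2 (lyz.trans lxz))]
      have h2 : 0 ≤ y ^ s * z ^ s * (x ^ (-b) * (y ^ (-b) + z ^ (-b))) := by positivity
      nlinarith

lemma integrable_sq_brokenPower_norm {a b : ℝ} (ha : a < 1) (hb : 1 < b) :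
    Integrable (fun x : Plane => brokenPower a b ‖x‖ ^ 2) := by
  rw [integrable_fun_norm_addHaar (μ := (volume : Measure Plane))
    (f := fun r => brokenPower a b r ^ 2)]
  have hdim : Module.finrank ℝ Plane - 1 = 1 := by simp
  have key (c : ℝ) {r : ℝ} (hr : 0 < r) : r ^ 1 * (r ^ (-c)) ^ 2 = r ^ (1 - 2 * c) := by
    rw [← rpow_natCast (r ^ (-c)), ← rpow_mul hr.le, pow_one, sub_eq_add_neg, rpow_add hr,
      rpow_one]
    congr 2
    push_cast
    ring
  rw [hdim, ← Set.Ioc_union_Ioi_eq_Ioi zero_le_one]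
  refine IntegrableOn.union ?_ ?_
  · have h : IntegrableOn (fun r : ℝ => r ^ (1 - 2 * a)) (Set.Ioc 0 1) :=
      (intervalIntegrable_iff_integrableOn_Ioc_of_le zero_le_one).1
        (intervalIntegral.intervalIntegrable_rpow' (by linarith))
    refine h.congr_fun (fun r hr => ?_) measurableSet_Ioc
    simp only [brokenPower, if_pos hr.2, smul_eq_mul]
    rw [key a hr.1]
  · have h : IntegrableOn (fun r : ℝ => r ^ (1 - 2 * b)) (Set.Ioi 1) :=
      integrableOn_Ioi_rpow_of_lt (by linarith) one_pos
    refine h.congr_fun (fun r hr => ?_) measurableSet_Ioi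
    simp only [brokenPower, if_neg (not_le.2 (Set.mem_Ioi.1 hr)), smul_eq_mul]
    rw [key b (one_pos.trans (Set.mem_Ioi.1 hr))]

lemma sq_sqrt_rpow {c : ℝ} (hc : 0 ≤ c) (t : ℝ) : (√c ^ t) ^ 2 = c ^ t := by
  rw [← rpow_natCast, ← rpow_mul (sqrt_nonneg c), sqrt_eq_rpow, ← rpow_mul hc]
  congr 1
  push_cast
  ring

lemma lintegral_ofReal_sq_lt_top {f : Plane → ℝ} (hf : Integrable fun x => f x ^ 2)
    (hf0 : ∀ x, 0 ≤ f x) :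
    ∫⁻ x, ENNReal.ofReal (f x) ^ 2 < ∞ := by
  simp only [← ENNReal.ofReal_pow (hf0 _)]
  exact hf.lintegral_lt_top

lemma integrable_sobolev_weight {t : ℝ} (ht : t ≤ 1) (u : 𝓢(Plane, ℂ)) :
    Integrable fun ξ : Plane => (1 + ‖ξ‖ ^ 2) ^ t * ‖u ξ‖ ^ 2 := by
  obtain ⟨C, hC⟩ := u.decay 0 0
  have hC' (ξ : Plane) : ‖u ξ‖ ≤ C := by simpa using hC.2 ξ
  have h0 := (u.integrable (μ := volume)).norm
  have h2 := u.integrable_pow_mul volume 2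
  refine ((h0.add h2).const_mul C).mono' ?_ ?_
  · have := u.continuous
    have h1 : Continuous fun ξ : Plane => (1 + ‖ξ‖ ^ 2) ^ t :=
      (by fun_prop : Continuous fun ξ : Plane => 1 + ‖ξ‖ ^ 2).rpow_const
        fun ξ => Or.inl (by positivity)
    exact (by fun_prop : Continuous _).aestronglyMeasurable
  · refine Filter.Eventually.of_forall fun ξ => ?_
    rw [norm_of_nonneg (by positivity)]
    have h1 : (1 + ‖ξ‖ ^ 2) ^ t ≤ 1 + ‖ξ‖ ^ 2 := by
      simpa using rpow_le_rpow_of_exponent_le (by nlinarith [sq_nonneg ‖ξ‖]) ht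
    calc _ ≤ (1 + ‖ξ‖ ^ 2) * (‖u ξ‖ * C) := by
          rw [pow_two ‖u ξ‖]
          gcongr
          exact hC' ξ
      _ = _ := by simp only [Pi.add_apply]; ring

/-- The estimate in `ℝ≥0∞`, with the constant depending only on the exponents and the third factor
measured in `L²`. -/
lemma exists_lintegral_fourier_mul_le {s σ : ℝ} (hs1 : s ≤ 1) (hσ : 0 < σ)
    (hσ1 : σ < 2 * s - 1) :
    ∃ K : ℝ≥0∞, K < ∞ ∧ ∀ u v w : 𝓢(Plane, ℂ),
      ∫⁻ ξ, ENNReal.ofReal (‖ξ‖ ^ (2 * (σ - 1)) * ‖𝓕 (fun x => u x * v x * w x) ξ‖ ^ 2) ≤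
        K * ((∫⁻ ξ, ENNReal.ofReal ((1 + ‖ξ‖ ^ 2) ^ s * ‖𝓕 (fun x => u x) ξ‖ ^ 2)) *
          (∫⁻ ξ, ENNReal.ofReal ((1 + ‖ξ‖ ^ 2) ^ s * ‖𝓕 (fun x => v x) ξ‖ ^ 2)) *
          ∫⁻ ξ, ‖𝓕 (fun x => w x) ξ‖ₑ ^ 2) := by
  set a : ℝ := 1 - σ with ha
  set b : ℝ := (a + 2 * s) / 2 with hb
  set M : Plane → ℝ≥0∞ := fun ξ => ENNReal.ofReal (brokenPower a b ‖ξ‖) with hM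
  set m : Plane → ℝ≥0∞ := fun ξ => ENNReal.ofReal (√(1 + ‖ξ‖ ^ 2) ^ (-b)) with hm
  set p : Plane → ℝ≥0∞ := fun ξ => ENNReal.ofReal (√(1 + ‖ξ‖ ^ 2) ^ s) with hp
  set W : Plane → ℝ≥0∞ := fun ξ => ENNReal.ofReal (‖ξ‖ ^ (-a)) with hW
  have IM : ∫⁻ ξ, M ξ ^ 2 < ∞ :=
    lintegral_ofReal_sq_lt_top (integrable_sq_brokenPower_norm (by linarith) (by linarith))
      fun ξ => brokenPower_nonneg _ _ (norm_nonneg ξ)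
  have Im : ∫⁻ ξ, m ξ ^ 2 < ∞ := by
    refine lintegral_ofReal_sq_lt_top ?_ fun ξ => by positivity
    have h := integrable_rpow_neg_one_add_norm_sq (E := Plane) (μ := volume) (r := 2 * b)
      (by simp; linarith)
    refine h.congr (Filter.Eventually.of_forall fun ξ => ?_)
    simp only
    rw [sq_sqrt_rpow (by positivity)]
    congr 1
    ring
  refine ⟨3 * ((∫⁻ x, m x ^ 2) ^ 2 + 2 * ((∫⁻ x, M x ^ 2) * ∫⁻ x, m x ^ 2)),
    by finiteness, fun u v w => ?_⟩
  have hweight : ∀ᵐ x, ∀ y z, W x ≤ p y * p z * (M x * (m y + m z) + m y * m z) := by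
    filter_upwards [Measure.ae_ne volume (0 : Plane)] with x hx y z
    have one_le (y : Plane) : 1 ≤ √(1 + ‖y‖ ^ 2) :=
      one_le_sqrt.2 (by nlinarith [sq_nonneg ‖y‖])
    have hx0 := norm_pos_iff.2 hx
    have hbx := brokenPower_nonneg a b hx0.le
    have h := rpow_neg_le_brokenPower (a := a) (b := b) (s := s) hx0 (one_le y) (one_le z)
      (by linarith) (by linarith) (by linarith) (by linarith)
    simp only [hW, hp, hM, hm]
    rw [← ENNReal.ofReal_mul (by positivity), ← ENNReal.ofReal_mul (by positivity),
      ← ENNReal.ofReal_add (by positivity) (by positivity), ← ENNReal.ofReal_mul (by positivity),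
      ← ENNReal.ofReal_add (by positivity) (by positivity), ← ENNReal.ofReal_mul (by positivity)]
    exact ENNReal.ofReal_le_ofReal h
  have meas (u : 𝓢(Plane, ℂ)) : Measurable fun ξ => ‖𝓕 (fun x => u x) ξ‖ₑ :=
    (𝓕 u).continuous.measurable.enorm
  have main := lintegral_sq_weight_mul_lconvolution_le (W := W) (M := M) (m := m) (p := p)
    ((measurable_brokenPower a b).comp measurable_norm).ennreal_ofReal (by fun_prop)
    (by fun_prop) (meas u) (meas v) (meas w) hweight
  have hsob (u : 𝓢(Plane, ℂ)) : ∫⁻ x, (p x * ‖𝓕 (fun x => u x) x‖ₑ) ^ 2 =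
      ∫⁻ ξ, ENNReal.ofReal ((1 + ‖ξ‖ ^ 2) ^ s * ‖𝓕 (fun x => u x) ξ‖ ^ 2) := by
    refine lintegral_congr fun ξ => ?_
    rw [hp, ← ofReal_norm, ← ENNReal.ofReal_mul (by positivity),
      ← ENNReal.ofReal_pow (by positivity), mul_pow, sq_sqrt_rpow (by positivity)]
  rw [hsob, hsob] at main
  refine le_trans (lintegral_mono fun ξ => ?_) main
  have hle : ‖𝓕 (fun x => u x * v x * w x) ξ‖ₑ ≤
      ((fun η => ‖𝓕 (fun x => u x) η‖ₑ) ⋆ₗ[volume] ((fun η => ‖𝓕 (fun x => v x) η‖ₑ) ⋆ₗ[volume]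
        fun η => ‖𝓕 (fun x => w x) η‖ₑ)) ξ := by
    simp only [mul_assoc]
    refine (enorm_fourier_mul_le u (SchwartzMap.pairing (ContinuousLinearMap.mul ℂ ℂ) v w) ξ).trans
      ?_
    rw [lconvolution_def, lconvolution_def]
    exact lintegral_mono fun η => mul_le_mul_right (enorm_fourier_mul_le v w _) _
  calc _ = (W ξ * ‖𝓕 (fun x => u x * v x * w x) ξ‖ₑ) ^ 2 := by
        rw [hW, ← ofReal_norm, ← ENNReal.ofReal_mul (by positivity),
          ← ENNReal.ofReal_pow (by positivity), mul_pow, ← rpow_natCast (‖ξ‖ ^ (-a)),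
          ← rpow_mul (norm_nonneg ξ)]
        congr 3
        push_cast
        ring
    _ ≤ _ := by gcongr

theorem cubic_estimate_B0 (s s' σ : ℝ)
    (hs : 1/2 < s) (hs1 : s ≤ 1) (hs' : 1/4 < s') (hs'1 : s' ≤ 1)
    (hσ : 0 < σ) (hσ1 : σ < 2 * s - 1) :
    ∃ C > 0, ∀ u v w : SchwartzMap Plane ℂ,
      homNorm (σ - 1) (fun x => u x * v x * w x) ≤
        C * sobNorm s (fun x => u x) * sobNorm s (fun x => v x) *
          sobNorm s' (fun x => w x) := by
  obtain ⟨K, hK, hmain⟩ := exists_lintegral_fourier_mul_le hs1 hσ hσ1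
  refine ⟨(K.toReal + 1) ^ (1 / 2 : ℝ), by positivity, fun u v w => ?_⟩
  have hsob {t : ℝ} (ht : t ≤ 1) (u : 𝓢(Plane, ℂ)) :
      ∫⁻ ξ, ENNReal.ofReal ((1 + ‖ξ‖ ^ 2) ^ t * ‖𝓕 (fun x => u x) ξ‖ ^ 2) =
        ENNReal.ofReal (∫ ξ : Plane, (1 + ‖ξ‖ ^ 2) ^ t * ‖𝓕 (fun x => u x) ξ‖ ^ 2) :=
    (ofReal_integral_eq_lintegral_ofReal (integrable_sobolev_weight ht (𝓕 u))
      (Filter.Eventually.of_forall fun ξ => by positivity)).symm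
  have hnonneg (t : ℝ) (u : 𝓢(Plane, ℂ)) :
      0 ≤ ∫ ξ : Plane, (1 + ‖ξ‖ ^ 2) ^ t * ‖𝓕 (fun x => u x) ξ‖ ^ 2 :=
    integral_nonneg fun ξ => by positivity
  have hw : ∫⁻ ξ, ‖𝓕 (fun x => w x) ξ‖ₑ ^ 2 ≤
      ∫⁻ ξ, ENNReal.ofReal ((1 + ‖ξ‖ ^ 2) ^ s' * ‖𝓕 (fun x => w x) ξ‖ ^ 2) := by
    refine lintegral_mono fun ξ => ?_
    rw [← ofReal_norm, ← ENNReal.ofReal_pow (norm_nonneg _)]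
    refine ENNReal.ofReal_le_ofReal (le_mul_of_one_le_left (by positivity) ?_)
    exact one_le_rpow (by nlinarith [sq_nonneg ‖ξ‖]) (by linarith)
  have h := (hmain u v w).trans (mul_le_mul_right (mul_le_mul_right hw _) _)
  rw [hsob hs1, hsob hs1, hsob hs'1, ← ENNReal.ofReal_mul (hnonneg _ _),
    ← ENNReal.ofReal_mul (mul_nonneg (hnonneg _ _) (hnonneg _ _)),
    ← ENNReal.ofReal_toReal hK.ne, ← ENNReal.ofReal_mul ENNReal.toReal_nonneg] at h
  unfold homNorm sobNorm
  have hU := hnonneg s u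
  have hV := hnonneg s v
  have hX := hnonneg s' w
  rw [← mul_rpow (by positivity) hU, ← mul_rpow (by positivity) hV,
    ← mul_rpow (by positivity) hX]
  refine rpow_le_rpow (integral_nonneg fun ξ => by positivity) ?_ (by norm_num)
  have hmeas : AEStronglyMeasurable (fun ξ : Plane =>
      ‖ξ‖ ^ (2 * (σ - 1)) * ‖𝓕 (fun x => u x * v x * w x) ξ‖ ^ 2) := by
    have hc : Measurable (𝓕 fun x => u x * v x * w x) :=
      (𝓕 (SchwartzMap.pairing (ContinuousLinearMap.mul ℂ ℂ)
        (SchwartzMap.pairing (ContinuousLinearMap.mul ℂ ℂ) u v) w)).continuous.measurable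
    exact Measurable.aestronglyMeasurable (by fun_prop)
  rw [integral_eq_lintegral_of_nonneg_ae (Filter.Eventually.of_forall fun ξ => by positivity) hmeas]
  refine (ENNReal.toReal_le_of_le_ofReal (by positivity) h).trans ?_
  nlinarith [mul_nonneg (mul_nonneg hU hV) hX]

end
end

section
/- Let 1/2 < s ≤ 1, 0 < σ < 2s − 1, and 1 < a < 2s. Then there exists a constant C > 0 such that for all Schwartz functions u, v, w on ℝ², ‖uvw‖_{Ḣ^{a−2}} ≤ C ‖u‖_{Ḣ^σ} ‖v‖_{H^s} ‖w‖_{H^s}. -/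
open MeasureTheory Real
open scoped FourierTransform

noncomputable section

/-- The radial profile dominating two of the four Sobolev weights: it blows up like `t ^ (-c)` at
the origin and decays like `t ^ (-q)` at infinity. -/
def radialMajorant (c q t : ℝ) : ℝ := if t < 1 then t ^ (-c) + 1 else t ^ (-q)

lemma radialMajorant_nonneg (c q : ℝ) {t : ℝ} (ht : 0 ≤ t) : 0 ≤ radialMajorant c q t := by
  unfold radialMajorant
  split_ifs <;> positivity

lemma measurable_radialMajorant (c q : ℝ) : Measurable (radialMajorant c q) :=
  Measurable.ite measurableSet_Iio (by fun_prop) (by fun_prop)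

lemma radialMajorant_max_one_le (c q : ℝ) {t : ℝ} (ht : 0 ≤ t) :
    radialMajorant c q (max 1 t) ≤ radialMajorant c q t := by
  rcases lt_or_ge t 1 with h | h
  · rw [max_eq_left h.le]
    simp only [radialMajorant, lt_irrefl, if_false, h, if_true, one_rpow]
    have : 0 ≤ t ^ (-c) := by positivity
    linarith
  · rw [max_eq_right h]

lemma prod_rpow_le_radialMajorant_of_le {c q t₁ t₂ t₃ t₄ a₁ a₂ a₃ a₄ : ℝ}
    (h0 : 0 < t₁) (h12 : t₁ ≤ t₂) (h23 : t₂ ≤ t₃) (h24 : t₂ ≤ t₄) (h3 : 1 ≤ t₃) (h4 : 1 ≤ t₄)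
    (ha₃ : 0 ≤ a₃) (ha₄ : 0 ≤ a₄) (haq₁ : a₁ ≤ q) (hc₁ : t₁ < 1 → a₁ ≤ c) (hc₂ : t₂ < 1 → a₂ ≤ c)
    (hsum : 2 * q ≤ a₁ + a₂ + a₃ + a₄) :
    t₁ ^ (-a₁) * t₂ ^ (-a₂) * t₃ ^ (-a₃) * t₄ ^ (-a₄) ≤
      radialMajorant c q t₁ * radialMajorant c q t₂ := by
  have h0' : 0 < t₂ := h0.trans_le h12
  have small : ∀ {t a : ℝ}, 0 < t → t < 1 → a ≤ c → t ^ (-a) ≤ radialMajorant c q t := by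
    intro t a ht ht1 hac
    rw [radialMajorant, if_pos ht1]
    linarith [rpow_le_rpow_of_exponent_ge ht ht1.le (neg_le_neg hac)]
  rcases lt_or_ge t₂ 1 with h | h
  · have e3 : t₃ ^ (-a₃) ≤ 1 := rpow_le_one_of_one_le_of_nonpos h3 (by linarith)
    have e4 : t₄ ^ (-a₄) ≤ 1 := rpow_le_one_of_one_le_of_nonpos h4 (by linarith)
    have h1 : t₁ < 1 := h12.trans_lt h
    calc t₁ ^ (-a₁) * t₂ ^ (-a₂) * t₃ ^ (-a₃) * t₄ ^ (-a₄)
        ≤ t₁ ^ (-a₁) * t₂ ^ (-a₂) * 1 * 1 := by gcongr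
      _ = t₁ ^ (-a₁) * t₂ ^ (-a₂) := by ring
      _ ≤ _ := mul_le_mul (small h0 h1 (hc₁ h1)) (small h0' h (hc₂ h)) (by positivity)
          (radialMajorant_nonneg _ _ h0.le)
  · have e3 : t₃ ^ (-a₃) ≤ t₂ ^ (-a₃) := rpow_le_rpow_of_nonpos h0' h23 (by linarith)
    have e4 : t₄ ^ (-a₄) ≤ t₂ ^ (-a₄) := rpow_le_rpow_of_nonpos h0' h24 (by linarith)
    have r2 : radialMajorant c q t₂ = t₂ ^ (-q) := if_neg (not_lt.2 h)
    have key : t₁ ^ (-a₁) * t₂ ^ (-a₂) * t₃ ^ (-a₃) * t₄ ^ (-a₄)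
        ≤ t₁ ^ (-a₁) * t₂ ^ (-(2 * q - a₁)) := by
      calc _ ≤ t₁ ^ (-a₁) * t₂ ^ (-a₂) * t₂ ^ (-a₃) * t₂ ^ (-a₄) := by gcongr
        _ = t₁ ^ (-a₁) * t₂ ^ (-a₂ + -a₃ + -a₄) := by
          rw [rpow_add h0', rpow_add h0']; ring
        _ ≤ _ := by
          gcongr
          linarith
    refine key.trans ?_
    rw [r2]
    rcases lt_or_ge t₁ 1 with h1 | h1
    · refine mul_le_mul (small h0 h1 (hc₁ h1)) ?_ (by positivity) (radialMajorant_nonneg _ _ h0.le)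
      exact rpow_le_rpow_of_exponent_le h (by linarith)
    · have r1 : radialMajorant c q t₁ = t₁ ^ (-q) := if_neg (not_lt.2 h1)
      rw [r1]
      calc t₁ ^ (-a₁) * t₂ ^ (-(2 * q - a₁))
          = t₁ ^ (-q) * t₁ ^ (q - a₁) * t₂ ^ (-(2 * q - a₁)) := by
            rw [← rpow_add h0]; congr 2; ring
        _ ≤ t₁ ^ (-q) * t₂ ^ (q - a₁) * t₂ ^ (-(2 * q - a₁)) := by
            gcongr
        _ = _ := by
            rw [mul_assoc, ← rpow_add h0']; congr 2; ring

lemma prod_rpow_le_radialMajorant {c q t₁ t₂ t₃ t₄ a₁ a₂ a₃ a₄ : ℝ}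
    (h1 : 0 < t₁) (h2 : 0 < t₂) (h13 : t₁ ≤ t₃) (h14 : t₁ ≤ t₄) (h23 : t₂ ≤ t₃) (h24 : t₂ ≤ t₄)
    (h3 : 1 ≤ t₃) (h4 : 1 ≤ t₄) (ha₃ : 0 ≤ a₃) (ha₄ : 0 ≤ a₄) (haq₁ : a₁ ≤ q) (haq₂ : a₂ ≤ q)
    (hc₁ : t₁ < 1 → a₁ ≤ c) (hc₂ : t₂ < 1 → a₂ ≤ c) (hsum : 2 * q ≤ a₁ + a₂ + a₃ + a₄) :
    t₁ ^ (-a₁) * t₂ ^ (-a₂) * t₃ ^ (-a₃) * t₄ ^ (-a₄) ≤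
      radialMajorant c q t₁ * radialMajorant c q t₂ := by
  rcases le_total t₁ t₂ with h | h
  · exact prod_rpow_le_radialMajorant_of_le h1 h h23 h24 h3 h4 ha₃ ha₄ haq₁ hc₁ hc₂ hsum
  · have := prod_rpow_le_radialMajorant_of_le (a₁ := a₂) (a₂ := a₁) h2 h h13 h14 h3 h4 ha₃ ha₄
      haq₂ hc₂ hc₁ (by linarith)
    rw [mul_comm (t₁ ^ (-a₁)), mul_comm (radialMajorant c q t₁)]
    exact this

/-- The sum of the products of distinct pairs among four numbers. -/
def pairSum {α : Type*} [Mul α] [Add α] (x₁ x₂ x₃ x₄ : α) : α :=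
  x₁ * x₂ + x₁ * x₃ + x₁ * x₄ + x₂ * x₃ + x₂ * x₄ + x₃ * x₄

lemma prod_rpow_le_pairSum {c q t₁ t₂ t₃ t₄ a₁ a₂ s : ℝ}
    (h1 : 0 < t₁) (h2 : 0 < t₂) (h3 : 1 ≤ t₃) (h4 : 1 ≤ t₄)
    (ha₁ : 0 ≤ a₁) (ha₂ : 0 ≤ a₂) (hs : 0 ≤ s) (haq₁ : a₁ ≤ q) (haq₂ : a₂ ≤ q) (hsq : s ≤ q)
    (hc₁ : a₁ ≤ c) (hc₂ : a₂ ≤ c) (hsum : 2 * q ≤ a₁ + a₂ + s + s) :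
    t₁ ^ (-a₁) * t₂ ^ (-a₂) * t₃ ^ (-s) * t₄ ^ (-s) ≤
      pairSum (radialMajorant c q t₁) (radialMajorant c q t₂) (radialMajorant c q t₃)
        (radialMajorant c q t₄) := by
  have p1 := radialMajorant_nonneg c q h1.le
  have p2 := radialMajorant_nonneg c q h2.le
  have p3 := radialMajorant_nonneg c q (zero_le_one.trans h3)
  have p4 := radialMajorant_nonneg c q (zero_le_one.trans h4)
  have n12 := mul_nonneg p1 p2
  have n13 := mul_nonneg p1 p3
  have n14 := mul_nonneg p1 p4
  have n23 := mul_nonneg p2 p3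
  have n24 := mul_nonneg p2 p4
  have n34 := mul_nonneg p3 p4
  have h3' : 0 < t₃ := zero_lt_one.trans_le h3
  have h4' : 0 < t₄ := zero_lt_one.trans_le h4
  have c3 : t₃ < 1 → s ≤ c := fun h => absurd h (not_lt.2 h3)
  have c4 : t₄ < 1 → s ≤ c := fun h => absurd h (not_lt.2 h4)
  have m12 (x13 : t₁ ≤ t₃) (x14 : t₁ ≤ t₄) (x23 : t₂ ≤ t₃) (x24 : t₂ ≤ t₄) :=
    prod_rpow_le_radialMajorant h1 h2 x13 x14 x23 x24 h3 h4 hs hs haq₁ haq₂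
      (fun _ => hc₁) (fun _ => hc₂) hsum
  have m13 (x12 : t₁ ≤ t₂) (x14 : t₁ ≤ t₄) (x32 : t₃ ≤ t₂) (x34 : t₃ ≤ t₄) :=
    prod_rpow_le_radialMajorant (c := c) (q := q) (a₁ := a₁) (a₂ := s) (a₃ := a₂) (a₄ := s)
      h1 h3' x12 x14 x32 x34 (h3.trans x32) h4 ha₂ hs haq₁ hsq (fun _ => hc₁) c3 (by linarith)
  have m14 (x12 : t₁ ≤ t₂) (x13 : t₁ ≤ t₃) (x42 : t₄ ≤ t₂) (x43 : t₄ ≤ t₃) :=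
    prod_rpow_le_radialMajorant (c := c) (q := q) (a₁ := a₁) (a₂ := s) (a₃ := a₂) (a₄ := s)
      h1 h4' x12 x13 x42 x43 (h4.trans x42) h3 ha₂ hs haq₁ hsq (fun _ => hc₁) c4 (by linarith)
  have m23 (x21 : t₂ ≤ t₁) (x24 : t₂ ≤ t₄) (x31 : t₃ ≤ t₁) (x34 : t₃ ≤ t₄) :=
    prod_rpow_le_radialMajorant (c := c) (q := q) (a₁ := a₂) (a₂ := s) (a₃ := a₁) (a₄ := s)
      h2 h3' x21 x24 x31 x34 (h3.trans x31) h4 ha₁ hs haq₂ hsq (fun _ => hc₂) c3 (by linarith)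
  have m24 (x21 : t₂ ≤ t₁) (x23 : t₂ ≤ t₃) (x41 : t₄ ≤ t₁) (x43 : t₄ ≤ t₃) :=
    prod_rpow_le_radialMajorant (c := c) (q := q) (a₁ := a₂) (a₂ := s) (a₃ := a₁) (a₄ := s)
      h2 h4' x21 x23 x41 x43 (h4.trans x41) h3 ha₁ hs haq₂ hsq (fun _ => hc₂) c4 (by linarith)
  have m34 (x31 : t₃ ≤ t₁) (x32 : t₃ ≤ t₂) (x41 : t₄ ≤ t₁) (x42 : t₄ ≤ t₂) :=
    prod_rpow_le_radialMajorant (c := c) (q := q) (a₁ := s) (a₂ := s) (a₃ := a₁) (a₄ := a₂)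
      h3' h4' x31 x32 x41 x42 (h3.trans x31) (h3.trans x32) ha₁ ha₂ hsq hsq c3 c4 (by linarith)
  unfold pairSum
  rcases le_total t₁ t₂ with x12 | x12 <;> rcases le_total t₁ t₃ with x13 | x13 <;>
  rcases le_total t₁ t₄ with x14 | x14 <;> rcases le_total t₂ t₃ with x23 | x23 <;>
  rcases le_total t₂ t₄ with x24 | x24 <;> rcases le_total t₃ t₄ with x34 | x34 <;>
  first
  | linarith [m12 (by linarith) (by linarith) (by linarith) (by linarith)]
  | linarith [m13 (by linarith) (by linarith) (by linarith) (by linarith)]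
  | linarith [m14 (by linarith) (by linarith) (by linarith) (by linarith)]
  | linarith [m23 (by linarith) (by linarith) (by linarith) (by linarith)]
  | linarith [m24 (by linarith) (by linarith) (by linarith) (by linarith)]
  | linarith [m34 (by linarith) (by linarith) (by linarith) (by linarith)]

lemma sobolev_weights_le_pairSum {c q t₁ t₂ t₃ t₄ b σ s : ℝ}
    (h1 : 0 ≤ t₁) (h2 : 0 ≤ t₂) (h3 : 0 ≤ t₃) (h4 : 0 ≤ t₄)
    (hb : 0 < b) (hσ : 0 < σ) (hs : 0 ≤ s) (hbq : b ≤ q) (hσq : σ ≤ q) (hsq : s ≤ q)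
    (hbc : b ≤ c) (hσc : σ ≤ c) (hsum : 2 * q ≤ b + σ + s + s) :
    t₁ ^ (-b) * t₂ ^ (-σ) * (1 + t₃ ^ 2) ^ (-s / 2) * (1 + t₄ ^ 2) ^ (-s / 2) ≤
      pairSum (radialMajorant c q t₁) (radialMajorant c q t₂) (radialMajorant c q t₃)
        (radialMajorant c q t₄) := by
  have p1 := radialMajorant_nonneg c q h1
  have p2 := radialMajorant_nonneg c q h2
  have p3 := radialMajorant_nonneg c q h3
  have p4 := radialMajorant_nonneg c q h4
  have hp : 0 ≤ pairSum (radialMajorant c q t₁) (radialMajorant c q t₂) (radialMajorant c q t₃)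
        (radialMajorant c q t₄) := by
    unfold pairSum
    positivity
  rcases h1.eq_or_lt with rfl | h1
  · rw [zero_rpow (by linarith)]
    simpa using hp
  rcases h2.eq_or_lt with rfl | h2
  · rw [zero_rpow (x := -σ) (by linarith)]
    simpa using hp
  have bracket : ∀ {t : ℝ}, 0 ≤ t → (1 + t ^ 2) ^ (-s / 2) ≤ (max 1 t) ^ (-s) := by
    intro t ht
    have hm : (0 : ℝ) < max 1 t := by positivity
    have : (max 1 t) ^ (-s) = ((max 1 t) ^ 2) ^ (-s / 2) := by
      rw [← rpow_natCast, ← rpow_mul hm.le]; congr 1; push_cast; ring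
    rw [this]
    refine rpow_le_rpow_of_nonpos (by positivity) ?_ (by linarith)
    rcases max_cases 1 t with h | h <;> rw [h.1] <;> nlinarith
  calc _ ≤ t₁ ^ (-b) * t₂ ^ (-σ) * (max 1 t₃) ^ (-s) * (max 1 t₄) ^ (-s) := by
        gcongr
        · exact bracket h3
        · exact bracket h4
    _ ≤ _ := prod_rpow_le_pairSum h1 h2 (le_max_left _ _) (le_max_left _ _) hb.le hσ.le hs hbq hσq
        hsq hbc hσc hsum
    _ ≤ _ := by
        have e3 := radialMajorant_max_one_le c q h3
        have e4 := radialMajorant_max_one_le c q h4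
        have q4 := radialMajorant_nonneg c q (t := max 1 t₄) (by positivity)
        unfold pairSum
        gcongr

lemma lintegral_radialMajorant_sq_lt_top {c q : ℝ} (hc0 : 0 ≤ c) (hc : c < 1) (hq : 1 < q) :
    ∫⁻ x : Plane, ENNReal.ofReal (radialMajorant c q ‖x‖) ^ 2 < ⊤ := by
  have hdim : Module.finrank ℝ Plane = 2 := by simp
  have hm : Measurable fun x : Plane => radialMajorant c q ‖x‖ ^ 2 :=
    ((measurable_radialMajorant c q).comp measurable_norm).pow_const 2
  have hball : IntegrableOn (fun x : Plane => radialMajorant c q ‖x‖ ^ 2) (Metric.ball 0 1) := by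
    refine integrableOn_ball_of_norm_le_rpow (C := 4) (α := 2 * c) (by simp)
      (by rw [hdim]; push_cast; linarith) ?_ hm.aestronglyMeasurable
    rw [ae_restrict_iff' measurableSet_ball]
    filter_upwards [Measure.ae_ne volume (0 : Plane)] with x hx0 hx
    rw [mem_ball_zero_iff] at hx
    have hx0 : 0 < ‖x‖ := norm_pos_iff.2 hx0
    rw [norm_of_nonneg (by positivity), radialMajorant, if_pos hx]
    have h1 : 1 ≤ ‖x‖ ^ (-c) := one_le_rpow_of_pos_of_le_one_of_nonpos hx0 hx.le (by linarith)
    have : ‖x‖ ^ (-(2 * c)) = (‖x‖ ^ (-c)) ^ 2 := by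
      rw [← rpow_natCast, ← rpow_mul hx0.le]; congr 1; push_cast; ring
    rw [this]
    nlinarith
  have hcompl : IntegrableOn (fun x : Plane => radialMajorant c q ‖x‖ ^ 2) (Metric.ball 0 1)ᶜ := by
    have := ((integrable_one_add_norm (μ := (volume : Measure Plane)) (r := 2 * q)
      (by rw [hdim]; push_cast; linarith)).const_mul (2 ^ (2 * q))).integrableOn
      (s := (Metric.ball 0 1)ᶜ)
    refine Integrable.mono' this hm.aestronglyMeasurable ?_
    rw [ae_restrict_iff' measurableSet_ball.compl]
    refine .of_forall fun x hx => ?_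
    have hx : 1 ≤ ‖x‖ := by simpa using hx
    have hx0 : 0 < ‖x‖ := by linarith
    rw [norm_of_nonneg (by positivity), radialMajorant, if_neg (not_lt.2 hx)]
    have : (‖x‖ ^ (-q)) ^ 2 = 2 ^ (2 * q) * (2 * ‖x‖) ^ (-(2 * q)) := by
      rw [mul_rpow zero_le_two hx0.le, ← mul_assoc, ← rpow_add zero_lt_two, ← rpow_natCast,
        ← rpow_mul hx0.le]
      simp
      congr 1; ring
    rw [this]
    exact mul_le_mul_of_nonneg_left
      (rpow_le_rpow_of_nonpos (by positivity) (by linarith) (by linarith)) (by positivity)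
  have hint : Integrable fun x : Plane => radialMajorant c q ‖x‖ ^ 2 := by
    rw [← integrableOn_univ, ← Set.union_compl_self (Metric.ball (0 : Plane) 1)]
    exact hball.union hcompl
  refine lt_of_eq_of_lt (lintegral_congr fun x => ?_) hint.lintegral_lt_top
  rw [ENNReal.ofReal_pow (radialMajorant_nonneg _ _ (norm_nonneg x))]

section Convolution

variable {E : Type*} [NormedAddCommGroup E] [InnerProductSpace ℝ E] [FiniteDimensional ℝ E]
  [MeasurableSpace E] [BorelSpace E]

lemma fourier_schwartz_mul (f g : SchwartzMap E ℂ) (ξ : E) :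
    𝓕 (fun x => f x * g x) ξ = ∫ t, 𝓕 f t * 𝓕 g (ξ - t) := by
  have h : 𝓕⁻ (fun x => f x * g x) (-ξ) = ∫ t, 𝓕⁻ f t * 𝓕⁻ g (-ξ - t) := by
    have h1 := SchwartzMap.convolution_apply (ContinuousLinearMap.mul ℂ ℂ) (𝓕⁻ f) (𝓕⁻ g) (-ξ)
    have h2 : SchwartzMap.convolution (ContinuousLinearMap.mul ℂ ℂ) (𝓕⁻ f) (𝓕⁻ g) =
        𝓕⁻ (SchwartzMap.pairing (ContinuousLinearMap.mul ℂ ℂ) f g) := by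
      simp [SchwartzMap.convolution]
    have h3 : ⇑(SchwartzMap.pairing (ContinuousLinearMap.mul ℂ ℂ) f g) = fun x => f x * g x := rfl
    rw [h2, SchwartzMap.fourierInv_coe, h3] at h1
    simpa [MeasureTheory.convolution] using h1
  have h3 : ∀ (F : E → ℂ) (x : E), 𝓕⁻ F (-x) = 𝓕 F x := fun F x => by
    rw [fourierInv_eq_fourier_neg, neg_neg]
  rw [h3] at h
  rw [h, ← integral_neg_eq_self]
  refine integral_congr_ae (.of_forall fun t => ?_)
  simp only [SchwartzMap.fourierInv_coe, SchwartzMap.fourier_coe]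
  rw [h3, ← h3 g]
  congr 2
  abel_nf

lemma enorm_fourier_schwartz_mul_le (f g : SchwartzMap E ℂ) (ξ : E) :
    ‖𝓕 (fun x => f x * g x) ξ‖ₑ ≤ ∫⁻ t, ‖𝓕 f t‖ₑ * ‖𝓕 g (ξ - t)‖ₑ := by
  rw [fourier_schwartz_mul]
  refine (enorm_integral_le_lintegral_enorm _).trans_eq ?_
  simp

lemma enorm_fourier_schwartz_mul_mul_le (u v w : SchwartzMap E ℂ) (ξ : E) :
    ‖𝓕 (fun x => u x * v x * w x) ξ‖ₑ ≤
      ∫⁻ η, ∫⁻ ζ, ‖𝓕 u η‖ₑ * (‖𝓕 v ζ‖ₑ * ‖𝓕 w (ξ - η - ζ)‖ₑ) := by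
  have h := enorm_fourier_schwartz_mul_le u
    (SchwartzMap.pairing (ContinuousLinearMap.mul ℂ ℂ) v w) ξ
  simp only [SchwartzMap.pairing_apply_apply, ContinuousLinearMap.mul_apply', ← mul_assoc] at h
  refine h.trans (lintegral_mono fun η => ?_)
  rw [lintegral_const_mul' _ _ enorm_ne_top]
  gcongr
  have := enorm_fourier_schwartz_mul_le v w (ξ - η)
  exact this

end Convolution

section Quadrilinear

variable {E P : Type*} [MeasureSpace E] [SFinite (volume : Measure E)] [MeasureSpace P]

lemma measurePreserving_triple_swap_left {x y z : P → E}
    (h : MeasurePreserving fun p => (x p, y p, z p)) :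
    MeasurePreserving fun p => (y p, x p, z p) := by
  have e : MeasurePreserving (fun p : E × E × E => (p.2.1, p.1, p.2.2)) :=
    (measurePreserving_prodAssoc volume volume volume).comp
      ((Measure.measurePreserving_swap.prod (.id volume)).comp
        (measurePreserving_prodAssoc volume volume volume).symm)
  exact e.comp h

lemma measurePreserving_triple_swap_right {x y z : P → E}
    (h : MeasurePreserving fun p => (x p, y p, z p)) :
    MeasurePreserving fun p => (x p, z p, y p) := by
  have e : MeasurePreserving (fun p : E × E × E => (p.1, p.2.2, p.2.1)) :=
    (MeasurePreserving.id volume).prod Measure.measurePreserving_swap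
  exact e.comp h

lemma lintegral_mul_mul_of_measurePreserving {x y z : P → E}
    (h : MeasurePreserving fun p => (x p, y p, z p)) {f g k : E → ENNReal}
    (hf : Measurable f) (hg : Measurable g) (hk : Measurable k) :
    ∫⁻ p, f (x p) * g (y p) * k (z p) = (∫⁻ t, f t) * (∫⁻ t, g t) * ∫⁻ t, k t := by
  have h1 := h.lintegral_comp (f := fun q : E × E × E => f q.1 * (g q.2.1 * k q.2.2))
    (by fun_prop)
  simp only [mul_assoc]
  rw [h1, Measure.volume_eq_prod,
    lintegral_prod_mul (g := fun q : E × E => g q.1 * k q.2) hf.aemeasurable (by fun_prop),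
    Measure.volume_eq_prod, lintegral_prod_mul hg.aemeasurable hk.aemeasurable]

/-- Cauchy–Schwarz for a product of four functions, two of whose arguments carry an additional
square-integrable weight. -/
lemma lintegral_weighted_pair_le {x y z t : P → E}
    (hz : MeasurePreserving fun p => (x p, y p, z p))
    (ht : MeasurePreserving fun p => (x p, y p, t p))
    {R f₁ f₂ f₃ f₄ : E → ENNReal} (hR : Measurable R)
    (h₁ : Measurable f₁) (h₂ : Measurable f₂) (h₃ : Measurable f₃) (h₄ : Measurable f₄) :
    ∫⁻ p, R (x p) * R (y p) * (f₁ (x p) * f₂ (y p) * f₃ (z p) * f₄ (t p)) ≤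
      (∫⁻ e, R e ^ 2) * ((∫⁻ e, f₁ e ^ 2) * (∫⁻ e, f₂ e ^ 2) * (∫⁻ e, f₃ e ^ 2) *
        (∫⁻ e, f₄ e ^ 2)) ^ (1 / 2 : ℝ) := by
  have hx : Measurable x := hz.measurable.fst
  have hy : Measurable y := hz.measurable.snd.fst
  have hz' : Measurable z := hz.measurable.snd.snd
  have ht' : Measurable t := ht.measurable.snd.snd
  have cs := ENNReal.lintegral_mul_le_Lp_mul_Lq (volume : Measure P) Real.HolderConjugate.two_two
    (f := fun p => R (x p) * f₂ (y p) * f₃ (z p)) (g := fun p => f₁ (x p) * R (y p) * f₄ (t p))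
    (by fun_prop) (by fun_prop)
  have e1 : ∫⁻ p, (R (x p) * f₂ (y p) * f₃ (z p)) ^ (2 : ℝ) =
      (∫⁻ e, R e ^ 2) * (∫⁻ e, f₂ e ^ 2) * (∫⁻ e, f₃ e ^ 2) := by
    rw [← lintegral_mul_mul_of_measurePreserving hz (by fun_prop) (by fun_prop) (by fun_prop)]
    simp only [ENNReal.rpow_ofNat, mul_pow]
  have e2 : ∫⁻ p, (f₁ (x p) * R (y p) * f₄ (t p)) ^ (2 : ℝ) =
      (∫⁻ e, f₁ e ^ 2) * (∫⁻ e, R e ^ 2) * (∫⁻ e, f₄ e ^ 2) := by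
    rw [← lintegral_mul_mul_of_measurePreserving ht (by fun_prop) (by fun_prop) (by fun_prop)]
    simp only [ENNReal.rpow_ofNat, mul_pow]
  rw [e1, e2, ← ENNReal.mul_rpow_of_nonneg _ _ (by norm_num)] at cs
  calc _ = ∫⁻ p, ((fun p => R (x p) * f₂ (y p) * f₃ (z p)) *
        fun p => f₁ (x p) * R (y p) * f₄ (t p)) p := by
        refine lintegral_congr fun p => ?_
        simp only [Pi.mul_apply]
        ring
    _ ≤ _ := cs
    _ = (((∫⁻ e, R e ^ 2) ^ (2 : ℝ)) * ((∫⁻ e, f₁ e ^ 2) * (∫⁻ e, f₂ e ^ 2) * (∫⁻ e, f₃ e ^ 2) *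
        (∫⁻ e, f₄ e ^ 2))) ^ (1 / 2 : ℝ) := by
        congr 1
        rw [ENNReal.rpow_ofNat]
        ring
    _ = _ := by
        rw [ENNReal.mul_rpow_of_nonneg _ _ (by norm_num), ← ENNReal.rpow_mul]
        norm_num

lemma lintegral_pairSum_le {x y z t : P → E}
    (hxyz : MeasurePreserving fun p => (x p, y p, z p))
    (hxyt : MeasurePreserving fun p => (x p, y p, t p))
    (hxzt : MeasurePreserving fun p => (x p, z p, t p))
    (hyzt : MeasurePreserving fun p => (y p, z p, t p))
    {R f₁ f₂ f₃ f₄ : E → ENNReal} (hR : Measurable R)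
    (h₁ : Measurable f₁) (h₂ : Measurable f₂) (h₃ : Measurable f₃) (h₄ : Measurable f₄) :
    ∫⁻ p, pairSum (R (x p)) (R (y p)) (R (z p)) (R (t p)) *
        (f₁ (x p) * f₂ (y p) * f₃ (z p) * f₄ (t p)) ≤
      6 * ((∫⁻ e, R e ^ 2) * ((∫⁻ e, f₁ e ^ 2) * (∫⁻ e, f₂ e ^ 2) * (∫⁻ e, f₃ e ^ 2) *
        (∫⁻ e, f₄ e ^ 2)) ^ (1 / 2 : ℝ)) := by
  have hx : Measurable x := hxyz.measurable.fst
  have hy : Measurable y := hxyz.measurable.snd.fst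
  have hz : Measurable z := hxyz.measurable.snd.snd
  have ht : Measurable t := hxyt.measurable.snd.snd
  have l {x y z : P → E} (h : MeasurePreserving fun p => (x p, y p, z p)) :=
    measurePreserving_triple_swap_left h
  have r {x y z : P → E} (h : MeasurePreserving fun p => (x p, y p, z p)) :=
    measurePreserving_triple_swap_right h
  have b12 := lintegral_weighted_pair_le hxyz hxyt hR h₁ h₂ h₃ h₄
  have b13 := lintegral_weighted_pair_le (r hxyz) hxzt hR h₁ h₃ h₂ h₄
  have b14 := lintegral_weighted_pair_le (r hxyt) (r hxzt) hR h₁ h₄ h₂ h₃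
  have b23 := lintegral_weighted_pair_le (r (l hxyz)) hyzt hR h₂ h₃ h₁ h₄
  have b24 := lintegral_weighted_pair_le (r (l hxyt)) (r hyzt) hR h₂ h₄ h₁ h₃
  have b34 := lintegral_weighted_pair_le (r (l hxzt)) (r (l hyzt)) hR h₃ h₄ h₁ h₂
  simp only [pairSum, add_mul]
  rw [lintegral_add_left (by fun_prop), lintegral_add_left (by fun_prop),
    lintegral_add_left (by fun_prop), lintegral_add_left (by fun_prop),
    lintegral_add_left (by fun_prop)]
  have six : ∀ X : ENNReal, 6 * X = X + X + X + X + X + X := fun X => by ring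
  rw [six]
  gcongr
  · exact (lintegral_congr fun p => by ring).trans_le (b13.trans_eq (by congr 2; ring))
  · exact (lintegral_congr fun p => by ring).trans_le (b14.trans_eq (by congr 2; ring))
  · exact (lintegral_congr fun p => by ring).trans_le (b23.trans_eq (by congr 2; ring))
  · exact (lintegral_congr fun p => by ring).trans_le (b24.trans_eq (by congr 2; ring))
  · exact (lintegral_congr fun p => by ring).trans_le (b34.trans_eq (by congr 2; ring))

end Quadrilinear

lemma lintegral_pairSum_sub_sub_le {E : Type*} [NormedAddCommGroup E] [InnerProductSpace ℝ E]
    [FiniteDimensional ℝ E] [MeasurableSpace E] [BorelSpace E]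
    {R f₁ f₂ f₃ f₄ : E → ENNReal} (hR : Measurable R)
    (h₁ : Measurable f₁) (h₂ : Measurable f₂) (h₃ : Measurable f₃) (h₄ : Measurable f₄) :
    ∫⁻ ξ, ∫⁻ η, ∫⁻ ζ, pairSum (R ξ) (R η) (R ζ) (R (ξ - η - ζ)) *
        (f₁ ξ * f₂ η * f₃ ζ * f₄ (ξ - η - ζ)) ≤
      6 * ((∫⁻ e, R e ^ 2) * ((∫⁻ e, f₁ e ^ 2) * (∫⁻ e, f₂ e ^ 2) * (∫⁻ e, f₃ e ^ 2) *
        (∫⁻ e, f₄ e ^ 2)) ^ (1 / 2 : ℝ)) := by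
  have hxyz : MeasurePreserving fun p : E × E × E => (p.1, p.2.1, p.2.2) := .id volume
  have shear : MeasurePreserving fun p : E × E × E => (p.1, p.2.1, p.1 - p.2.1 - p.2.2) := by
    refine MeasurePreserving.skew_product (g := fun ξ (p : E × E) => (p.1, ξ - p.1 - p.2))
      (.id volume) (by fun_prop) (.of_forall fun ξ => ?_)
    exact (MeasurePreserving.skew_product (g := fun η ζ : E => ξ - η - ζ) (.id volume)
      (by fun_prop) (.of_forall fun η =>
        (Measure.measurePreserving_sub_left volume (ξ - η)).map_eq)).map_eq
  have shear' : MeasurePreserving fun p : E × E × E => (p.1, p.2.1, p.2.2 - p.1 - p.2.1) := by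
    refine MeasurePreserving.skew_product (g := fun ξ (p : E × E) => (p.1, p.2 - ξ - p.1))
      (.id volume) (by fun_prop) (.of_forall fun ξ => ?_)
    refine (MeasurePreserving.skew_product (g := fun η ζ : E => ζ - ξ - η) (.id volume)
      (by fun_prop) (.of_forall fun η => ?_)).map_eq
    simp only [sub_sub]
    exact (MeasureTheory.measurePreserving_sub_right volume (ξ + η)).map_eq
  have hxzt : MeasurePreserving fun p : E × E × E => (p.1, p.2.2, p.1 - p.2.1 - p.2.2) := by
    have := shear.comp (measurePreserving_triple_swap_right hxyz)
    simpa only [Function.comp_def, sub_right_comm] using this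
  have hyzt : MeasurePreserving fun p : E × E × E => (p.2.1, p.2.2, p.1 - p.2.1 - p.2.2) :=
    shear'.comp (measurePreserving_triple_swap_right (measurePreserving_triple_swap_left hxyz))
  refine le_trans (le_of_eq ?_) (lintegral_pairSum_le hxyz shear hxzt hyzt hR h₁ h₂ h₃ h₄)
  rw [Measure.volume_eq_prod, lintegral_prod _ (by unfold pairSum; fun_prop)]
  refine lintegral_congr fun ξ => ?_
  rw [Measure.volume_eq_prod, lintegral_prod _ (by unfold pairSum; fun_prop)]

lemma homNorm_eq_lintegral (r : ℝ) (f : SchwartzMap Plane ℂ) :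
    homNorm r f =
      (∫⁻ ξ, ENNReal.ofReal (‖ξ‖ ^ r * ‖𝓕 f ξ‖) ^ 2).toReal ^ (1 / 2 : ℝ) := by
  have hm : Measurable fun ξ => ‖𝓕 f ξ‖ := (𝓕 f).continuous.norm.measurable
  rw [homNorm, integral_eq_lintegral_of_nonneg_ae (.of_forall fun ξ => by positivity)
    (Measurable.aestronglyMeasurable (by simp only [← SchwartzMap.fourier_coe]; fun_prop))]
  congr 2
  refine lintegral_congr fun ξ => ?_
  rw [← ENNReal.ofReal_pow (by positivity), mul_pow, SchwartzMap.fourier_coe,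
    ← rpow_mul_natCast (norm_nonneg ξ)]
  congr 3
  push_cast
  ring

lemma sobNorm_eq_lintegral (s : ℝ) (f : SchwartzMap Plane ℂ) :
    sobNorm s f =
      (∫⁻ ξ, ENNReal.ofReal ((1 + ‖ξ‖ ^ 2) ^ (s / 2) * ‖𝓕 f ξ‖) ^ 2).toReal ^ (1 / 2 : ℝ) := by
  have hm : Measurable fun ξ => ‖𝓕 f ξ‖ := (𝓕 f).continuous.norm.measurable
  rw [sobNorm, integral_eq_lintegral_of_nonneg_ae (.of_forall fun ξ => by positivity)
    (Measurable.aestronglyMeasurable (by simp only [← SchwartzMap.fourier_coe]; fun_prop))]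
  congr 2
  refine lintegral_congr fun ξ => ?_
  rw [← ENNReal.ofReal_pow (by positivity), mul_pow, SchwartzMap.fourier_coe,
    ← rpow_mul_natCast (by positivity)]
  congr 3
  push_cast
  ring

lemma lintegral_schwartz_weighted_sq_lt_top (f : SchwartzMap Plane ℂ) {m : Plane → ℝ}
    (hm0 : ∀ ξ, 0 ≤ m ξ) (hm : ∀ ξ, m ξ ^ 2 ≤ 1 + ‖ξ‖ ^ 2) :
    ∫⁻ ξ, ENNReal.ofReal (m ξ * ‖f ξ‖) ^ 2 < ⊤ := by
  obtain ⟨C, hC⟩ := f.decay 0 0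
  have hC : ∀ ξ, ‖f ξ‖ ≤ C := fun ξ => by simpa using hC.2 ξ
  have hint := ((f.integrable_pow_mul volume 0).add (f.integrable_pow_mul volume 2)).mul_const C
  refine lt_of_le_of_lt (lintegral_mono fun ξ => ?_) hint.lintegral_lt_top
  rw [← ENNReal.ofReal_pow (mul_nonneg (hm0 ξ) (norm_nonneg _))]
  refine ENNReal.ofReal_le_ofReal ?_
  calc (m ξ * ‖f ξ‖) ^ 2 = m ξ ^ 2 * (‖f ξ‖ * ‖f ξ‖) := by ring
    _ ≤ (1 + ‖ξ‖ ^ 2) * (‖f ξ‖ * C) := by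
        gcongr
        · exact hm ξ
        · exact hC ξ
    _ = _ := by simp only [Pi.add_apply]; ring

lemma rpow_sq_le_one_add_sq {r t : ℝ} (hr0 : 0 ≤ r) (hr : r ≤ 1) (ht : 0 ≤ t) :
    (t ^ r) ^ 2 ≤ 1 + t ^ 2 := by
  rcases le_total t 1 with h | h
  · have := rpow_le_one ht h hr0
    nlinarith [rpow_nonneg ht r]
  · have : t ^ r ≤ t := by simpa using rpow_le_rpow_of_exponent_le h hr
    nlinarith [rpow_nonneg ht r]

lemma one_add_sq_rpow_half_sq_le {r t : ℝ} (hr : r ≤ 1) :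
    ((1 + t ^ 2) ^ (r / 2)) ^ 2 ≤ 1 + t ^ 2 := by
  rw [← rpow_mul_natCast (by positivity)]
  simpa using rpow_le_rpow_of_exponent_le (x := 1 + t ^ 2) (by nlinarith) hr

/-- The trilinear estimate in terms of squared weighted `L²` norms on the Fourier side. -/
lemma lintegral_fourier_mul_mul_sq_le {c q b σ s : ℝ}
    (hb : 0 < b) (hσ : 0 < σ) (hs : 0 ≤ s) (hbq : b ≤ q) (hσq : σ ≤ q) (hsq : s ≤ q)
    (hbc : b ≤ c) (hσc : σ ≤ c) (hsum : 2 * q ≤ b + σ + s + s) (p u v w : SchwartzMap Plane ℂ)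
    (hp : (p : Plane → ℂ) = fun x => u x * v x * w x) :
    ∫⁻ ξ, ENNReal.ofReal (‖ξ‖ ^ (-b) * ‖𝓕 p ξ‖) ^ 2 ≤
      6 * ((∫⁻ x : Plane, ENNReal.ofReal (radialMajorant c q ‖x‖) ^ 2) *
        ((∫⁻ ξ, ENNReal.ofReal (‖ξ‖ ^ (-b) * ‖𝓕 p ξ‖) ^ 2) *
        (∫⁻ ξ, ENNReal.ofReal (‖ξ‖ ^ σ * ‖𝓕 u ξ‖) ^ 2) *
        (∫⁻ ξ, ENNReal.ofReal ((1 + ‖ξ‖ ^ 2) ^ (s / 2) * ‖𝓕 v ξ‖) ^ 2) *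
        (∫⁻ ξ, ENNReal.ofReal ((1 + ‖ξ‖ ^ 2) ^ (s / 2) * ‖𝓕 w ξ‖) ^ 2)) ^ (1 / 2 : ℝ)) := by
  have hmeas (f : SchwartzMap Plane ℂ) : Measurable fun ξ => ‖𝓕 f ξ‖ :=
    (𝓕 f).continuous.norm.measurable
  have hmp := hmeas p
  have hmu := hmeas u
  have hmv := hmeas v
  have hmw := hmeas w
  have hR : Measurable fun x : Plane => ENNReal.ofReal (radialMajorant c q ‖x‖) :=
    ((measurable_radialMajorant c q).comp measurable_norm).ennreal_ofReal
  refine le_trans (lintegral_mono fun ξ => ?_) (lintegral_pairSum_sub_sub_le hR (by fun_prop)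
    (by fun_prop) (by fun_prop) (by fun_prop))
  have hconv : ‖𝓕 p ξ‖ₑ ≤ ∫⁻ η, ∫⁻ ζ, ‖𝓕 u η‖ₑ * (‖𝓕 v ζ‖ₑ * ‖𝓕 w (ξ - η - ζ)‖ₑ) := by
    have := enorm_fourier_schwartz_mul_mul_le u v w ξ
    rwa [← hp] at this
  have hsplit : ENNReal.ofReal (‖ξ‖ ^ (-b) * ‖𝓕 p ξ‖) ^ 2 =
      ENNReal.ofReal (‖ξ‖ ^ (-b) * (‖ξ‖ ^ (-b) * ‖𝓕 p ξ‖)) * ‖𝓕 p ξ‖ₑ := by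
    rw [← ofReal_norm, ← ENNReal.ofReal_pow (by positivity),
      ← ENNReal.ofReal_mul (by positivity)]
    congr 1; ring
  rw [hsplit]
  refine (mul_le_mul_right hconv _).trans ((lintegral_const_mul_le _ _).trans ?_)
  refine lintegral_mono_ae ?_
  filter_upwards [Measure.ae_ne volume (0 : Plane)] with η hη
  refine (lintegral_const_mul_le _ _).trans (lintegral_mono fun ζ => ?_)
  have hη : 0 < ‖η‖ := norm_pos_iff.2 hη
  have hr (x : Plane) := radialMajorant_nonneg c q (norm_nonneg x)
  have hpair : pairSum (ENNReal.ofReal (radialMajorant c q ‖ξ‖))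
      (ENNReal.ofReal (radialMajorant c q ‖η‖)) (ENNReal.ofReal (radialMajorant c q ‖ζ‖))
      (ENNReal.ofReal (radialMajorant c q ‖ξ - η - ζ‖)) =
      ENNReal.ofReal (pairSum (radialMajorant c q ‖ξ‖) (radialMajorant c q ‖η‖)
        (radialMajorant c q ‖ζ‖) (radialMajorant c q ‖ξ - η - ζ‖)) := by
    have n1 := hr ξ
    have n2 := hr η
    have n3 := hr ζ
    have n4 := hr (ξ - η - ζ)
    unfold pairSum
    repeat rw [ENNReal.ofReal_add (by positivity) (by positivity)]
    simp only [ENNReal.ofReal_mul n1, ENNReal.ofReal_mul n2, ENNReal.ofReal_mul n3]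
  have hW := sobolev_weights_le_pairSum (norm_nonneg ξ) (norm_nonneg η) (norm_nonneg ζ)
    (norm_nonneg (ξ - η - ζ)) hb hσ hs hbq hσq hsq hbc hσc hsum
  have cancel (x : Plane) : (1 + ‖x‖ ^ 2) ^ (-s / 2) * (1 + ‖x‖ ^ 2) ^ (s / 2) = 1 := by
    rw [← rpow_add (by positivity)]
    ring_nf
    exact rpow_zero _
  have cancel' : ‖η‖ ^ (-σ) * ‖η‖ ^ σ = 1 := by
    rw [← rpow_add hη]; simp
  rw [hpair]
  simp only [← ofReal_norm]
  repeat rw [← ENNReal.ofReal_mul (by positivity)]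
  rw [← ENNReal.ofReal_mul ((by positivity : (0 : ℝ) ≤ _).trans hW)]
  refine ENNReal.ofReal_le_ofReal ?_
  calc _ = ‖ξ‖ ^ (-b) * (‖ξ‖ ^ (-b) * ‖𝓕 p ξ‖) * (‖𝓕 u η‖ * (‖𝓕 v ζ‖ * ‖𝓕 w (ξ - η - ζ)‖)) *
        ((‖η‖ ^ (-σ) * ‖η‖ ^ σ) * ((1 + ‖ζ‖ ^ 2) ^ (-s / 2) * (1 + ‖ζ‖ ^ 2) ^ (s / 2)) *
        ((1 + ‖ξ - η - ζ‖ ^ 2) ^ (-s / 2) * (1 + ‖ξ - η - ζ‖ ^ 2) ^ (s / 2))) := by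
        rw [cancel, cancel, cancel']; ring
    _ = (‖ξ‖ ^ (-b) * ‖η‖ ^ (-σ) * (1 + ‖ζ‖ ^ 2) ^ (-s / 2) *
        (1 + ‖ξ - η - ζ‖ ^ 2) ^ (-s / 2)) * (‖ξ‖ ^ (-b) * ‖𝓕 p ξ‖ * (‖η‖ ^ σ * ‖𝓕 u η‖) *
        ((1 + ‖ζ‖ ^ 2) ^ (s / 2) * ‖𝓕 v ζ‖) *
        ((1 + ‖ξ - η - ζ‖ ^ 2) ^ (s / 2) * ‖𝓕 w (ξ - η - ζ)‖)) := by ring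
    _ ≤ _ := mul_le_mul_of_nonneg_right hW (by positivity)

lemma rpow_half_toReal_le_of_le {J I N₂ N₃ N₄ : ENNReal} (hI : I < ⊤) (h2 : N₂ < ⊤) (h3 : N₃ < ⊤)
    (h4 : N₄ < ⊤) (h : J ≤ 6 * (I * (J * N₂ * N₃ * N₄) ^ (1 / 2 : ℝ))) :
    J.toReal ^ (1 / 2 : ℝ) ≤ 6 * I.toReal * N₂.toReal ^ (1 / 2 : ℝ) * N₃.toReal ^ (1 / 2 : ℝ) *
      N₄.toReal ^ (1 / 2 : ℝ) := by
  rcases eq_or_ne J ⊤ with rfl | hJ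
  · rw [ENNReal.toReal_top, zero_rpow (by norm_num)]
    positivity
  have hfin : J * N₂ * N₃ * N₄ ≠ ⊤ :=
    ENNReal.mul_ne_top (ENNReal.mul_ne_top (ENNReal.mul_ne_top hJ h2.ne) h3.ne) h4.ne
  have hr := ENNReal.toReal_mono (ENNReal.mul_ne_top (by norm_num)
    (ENNReal.mul_ne_top hI.ne (ENNReal.rpow_ne_top_of_nonneg (by norm_num) hfin))) h
  simp only [ENNReal.toReal_mul, ← ENNReal.toReal_rpow] at hr
  rw [mul_rpow (by positivity) (by positivity), mul_rpow (by positivity) (by positivity),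
    mul_rpow (by positivity) (by positivity)] at hr
  simp only [ENNReal.toReal_ofNat, ← sqrt_eq_rpow] at hr ⊢
  rcases (sqrt_nonneg J.toReal).eq_or_lt with h0 | h0
  · rw [← h0]; positivity
  · refine le_of_mul_le_mul_right ?_ h0
    rw [mul_self_sqrt ENNReal.toReal_nonneg]
    exact hr.trans_eq (by ring)

theorem cubic_estimate_A0 (s σ a : ℝ)
    (hs : 1/2 < s) (hs1 : s ≤ 1) (hσ : 0 < σ) (hσ1 : σ < 2 * s - 1)
    (ha : 1 < a) (ha1 : a < 2 * s) :
    ∃ C > 0, ∀ u v w : SchwartzMap Plane ℂ,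
      homNorm (a - 2) (fun x => u x * v x * w x) ≤
        C * homNorm σ (fun x => u x) * sobNorm s (fun x => v x) *
          sobNorm s (fun x => w x) := by
  set q : ℝ := (2 - a + σ + s + s) / 2 with hq
  set c : ℝ := max (2 - a) σ with hc
  have hI := lintegral_radialMajorant_sq_lt_top (c := c) (q := q) (le_max_of_le_right hσ.le)
    (max_lt (by linarith) (by linarith)) (by linarith)
  refine ⟨6 * (∫⁻ x : Plane, ENNReal.ofReal (radialMajorant c q ‖x‖) ^ 2).toReal + 1,
    by positivity, fun u v w => ?_⟩
  let p := SchwartzMap.pairing (ContinuousLinearMap.mul ℂ ℂ)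
    (SchwartzMap.pairing (ContinuousLinearMap.mul ℂ ℂ) u v) w
  have hp : (p : Plane → ℂ) = fun x => u x * v x * w x := rfl
  have key := lintegral_fourier_mul_mul_sq_le (c := c) (q := q) (b := 2 - a) (σ := σ) (s := s)
    (by linarith) hσ (by linarith) (by linarith) (by linarith) (by linarith) (le_max_left _ _)
    (le_max_right _ _) (by linarith) p u v w hp
  have hu := lintegral_schwartz_weighted_sq_lt_top (𝓕 u) (m := fun ξ => ‖ξ‖ ^ σ)
    (fun ξ => by positivity)
    (fun ξ => rpow_sq_le_one_add_sq hσ.le (by linarith) (norm_nonneg ξ))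
  have hsob (f : SchwartzMap Plane ℂ) := lintegral_schwartz_weighted_sq_lt_top (𝓕 f)
    (m := fun ξ => (1 + ‖ξ‖ ^ 2) ^ (s / 2)) (fun ξ => by positivity)
    (fun ξ => one_add_sq_rpow_half_sq_le hs1)
  have main := rpow_half_toReal_le_of_le hI hu (hsob v) (hsob w) key
  rw [neg_sub, ← homNorm_eq_lintegral, ← homNorm_eq_lintegral, ← sobNorm_eq_lintegral,
    ← sobNorm_eq_lintegral, hp] at main
  refine main.trans ?_
  have hu0 : 0 ≤ homNorm σ u := by rw [homNorm_eq_lintegral]; positivity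
  have hv0 : 0 ≤ sobNorm s v := by rw [sobNorm_eq_lintegral]; positivity
  have hw0 : 0 ≤ sobNorm s w := by rw [sobNorm_eq_lintegral]; positivity
  gcongr
  linarith

end
end
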